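/- Let p ∈ [1, ∞), ε > 0, let c : X × Y → ℝ be continuous with growth of order at most p, and let μ^n ∈ P_p(X), ν^n ∈ P_p(Y) converge to μ ∈ P_p(X), ν ∈ P_p(Y) in the bicausal Wasserstein distance W_{p,bc}. Then E_•^ε(μ^n, ν^n, c) → E_•^ε(μ, ν, c) as n → ∞, and the (unique) optimizers of E_•^ε(μ^n, ν^n, c) converge in the Wasserstein distance W_p to the optimizer of E_•^ε(μ, ν, c), where • stands for any of: no constraint, causal, anticausal, or bicausal. -/

import Mathlib

open MeasureTheory ProbabilityTheory Filter Set
open scoped ENNReal NNReal Topology ProbabilityTheory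

noncomputable section

namespace AOT

variable {N : ℕ}

/-- The σ-algebra on a path space generated by the `t`-th coordinate. -/
def coordσ (X : Fin N → Type*) [∀ t, MeasurableSpace (X t)] (t : Fin N) :
    MeasurableSpace (∀ s, X s) :=
  MeasurableSpace.comap (fun x => x t) inferInstance

/-- The σ-algebra generated by the coordinates (strictly) before time `t`, from a family
of coordinate σ-algebras. -/
def pastσOf {A : Type*} (m : Fin N → MeasurableSpace A) (t : ℕ) : MeasurableSpace A :=
  ⨆ s : Fin N, ⨆ _ : (s : ℕ) < t, m s

/-- The σ-algebra on a path space generated by the coordinates before time `t`. -/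
def pastσ (X : Fin N → Type*) [∀ t, MeasurableSpace (X t)] (t : ℕ) :
    MeasurableSpace (∀ s, X s) :=
  pastσOf (coordσ X) t

/-- Conditional independence of the sub-σ-algebras `m₁` and `m₂` given `m₃`, under the
measure `π`: for all sets `A ∈ m₁`, `B ∈ m₂`, the conditional expectation (given `m₃`)
of the indicator of `A ∩ B` is a.s. the product of those of `A` and of `B`. -/
def CondIndepσ {Ω : Type*} {mΩ : MeasurableSpace Ω} (m₁ m₂ m₃ : MeasurableSpace Ω)
    (π : @Measure Ω mΩ) : Prop :=
  ∀ A B : Set Ω, MeasurableSet[m₁] A → MeasurableSet[m₂] B →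
    (π[(A ∩ B).indicator (fun _ => (1 : ℝ)) | m₃]) =ᵐ[π]
      (π[A.indicator (fun _ => (1 : ℝ)) | m₃]) * (π[B.indicator (fun _ => (1 : ℝ)) | m₃])

/-- Causality of a measure on `A × B` relative to families of coordinate σ-algebras
`mA` on `A` and `mB` on `B`: for every time `t`, the `t`-th coordinate of the first
component is conditionally independent of the (strict) past of the second component,
given the (strict) past of the first component. -/
def IsCausalFor {A B : Type*} [MeasurableSpace A] [MeasurableSpace B]
    (mA : Fin N → MeasurableSpace A) (mB : Fin N → MeasurableSpace B)
    (π : Measure (A × B)) : Prop :=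
  ∀ t : Fin N,
    CondIndepσ ((mA t).comap Prod.fst)
      ((pastσOf mB (t : ℕ)).comap Prod.snd)
      ((pastσOf mA (t : ℕ)).comap Prod.fst) π

/-- Anticausality: causality with the roles of the two components exchanged. -/
def IsAnticausalFor {A B : Type*} [MeasurableSpace A] [MeasurableSpace B]
    (mA : Fin N → MeasurableSpace A) (mB : Fin N → MeasurableSpace B)
    (π : Measure (A × B)) : Prop :=
  IsCausalFor mB mA (π.map Prod.swap)

/-- A coupling of a measure on `X₁ × ⋯ × X_N` and a measure on `Y₁ × ⋯ × Y_N` is causal if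
under it, for every `t`, `Y_{1:t}` is conditionally independent of `X_{t+1}` given `X_{1:t}`. -/
def IsCausal {X Y : Fin N → Type*} [∀ t, MeasurableSpace (X t)] [∀ t, MeasurableSpace (Y t)]
    (π : Measure ((∀ t, X t) × (∀ t, Y t))) : Prop :=
  IsCausalFor (coordσ X) (coordσ Y) π

def IsAnticausal {X Y : Fin N → Type*} [∀ t, MeasurableSpace (X t)] [∀ t, MeasurableSpace (Y t)]
    (π : Measure ((∀ t, X t) × (∀ t, Y t))) : Prop :=
  IsAnticausalFor (coordσ X) (coordσ Y) π

def IsBicausal {X Y : Fin N → Type*} [∀ t, MeasurableSpace (X t)] [∀ t, MeasurableSpace (Y t)]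
    (π : Measure ((∀ t, X t) × (∀ t, Y t))) : Prop :=
  IsCausal π ∧ IsAnticausal π

/-- `π` is a coupling of `μ` and `ν`. -/
def IsCoupling {A B : Type*} [MeasurableSpace A] [MeasurableSpace B]
    (μ : Measure A) (ν : Measure B) (π : Measure (A × B)) : Prop :=
  π.map Prod.fst = μ ∧ π.map Prod.snd = ν

/-- The four flavors of (adapted) optimal transport: plain, causal, anticausal, bicausal. -/
inductive Flavor | plain | causal | anticausal | bicausal

/-- The adaptedness constraint corresponding to a flavor. -/
def IsAdapted {X Y : Fin N → Type*} [∀ t, MeasurableSpace (X t)] [∀ t, MeasurableSpace (Y t)] :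
    Flavor → Measure ((∀ t, X t) × (∀ t, Y t)) → Prop
  | .plain => fun _ => True
  | .causal => fun π => IsCausal π
  | .anticausal => fun π => IsAnticausal π
  | .bicausal => fun π => IsBicausal π

/-- The set `Π_•(μ, ν)` of couplings of `μ` and `ν` with the adaptedness constraint
given by the flavor `b`. -/
def aCouplings {X Y : Fin N → Type*} [∀ t, MeasurableSpace (X t)] [∀ t, MeasurableSpace (Y t)]
    (b : Flavor) (μ : Measure (∀ t, X t)) (ν : Measure (∀ t, Y t)) :
    Set (Measure ((∀ t, X t) × (∀ t, Y t))) :=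
  {π | IsCoupling μ ν π ∧ IsAdapted b π}

/-- `p`-th power transport cost of a coupling. -/
def lcost (p : ℝ) {A : Type*} [MeasurableSpace A] [PseudoEMetricSpace A]
    (π : Measure (A × A)) : ℝ≥0∞ :=
  ∫⁻ z, edist z.1 z.2 ^ p ∂π

/-- The (adapted) Wasserstein distance `W_{p,•}` between two measures on a path space. -/
def W {X : Fin N → Type*} [∀ t, MeasurableSpace (X t)] [∀ t, PseudoEMetricSpace (X t)]
    (p : ℝ) (b : Flavor) (μ ν : Measure (∀ t, X t)) : ℝ≥0∞ :=
  (⨅ π : aCouplings b μ ν, lcost p π.1) ^ (1 / p)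

/-- Coordinate σ-algebras on `X × Y` viewed as a single path space with
coordinates `X_t × Y_t`. -/
def coordσ2 (X Y : Fin N → Type*) [∀ t, MeasurableSpace (X t)] [∀ t, MeasurableSpace (Y t)]
    (t : Fin N) : MeasurableSpace ((∀ s, X s) × (∀ s, Y s)) :=
  ((coordσ X t).comap Prod.fst) ⊔ ((coordσ Y t).comap Prod.snd)

/-- Adaptedness for measures on `(X × Y) × (X × Y)`, where `X × Y` is regarded as a single
path space with `N` time steps, the `t`-th coordinate being `X_t × Y_t`. -/
def IsAdapted2 {X Y : Fin N → Type*} [∀ t, MeasurableSpace (X t)] [∀ t, MeasurableSpace (Y t)] :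
    Flavor → Measure (((∀ t, X t) × (∀ t, Y t)) × ((∀ t, X t) × (∀ t, Y t))) → Prop
  | .plain => fun _ => True
  | .causal => fun θ => IsCausalFor (coordσ2 X Y) (coordσ2 X Y) θ
  | .anticausal => fun θ => IsAnticausalFor (coordσ2 X Y) (coordσ2 X Y) θ
  | .bicausal => fun θ => IsCausalFor (coordσ2 X Y) (coordσ2 X Y) θ ∧
      IsAnticausalFor (coordσ2 X Y) (coordσ2 X Y) θ

/-- The set `Π_•(π, π̃)` of couplings of two measures on `X × Y`, with adaptedness understood
for `X × Y` as one path space. -/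
def aCouplings2 {X Y : Fin N → Type*} [∀ t, MeasurableSpace (X t)] [∀ t, MeasurableSpace (Y t)]
    (b : Flavor) (π ρ : Measure ((∀ t, X t) × (∀ t, Y t))) :
    Set (Measure (((∀ t, X t) × (∀ t, Y t)) × ((∀ t, X t) × (∀ t, Y t)))) :=
  {θ | IsCoupling π ρ θ ∧ IsAdapted2 b θ}

/-- `p`-th power transport cost `∫ d_X(x,x̃)^p + d_Y(y,ỹ)^p dθ` for couplings of couplings. -/
def lcost2 (p : ℝ) {A B : Type*} [MeasurableSpace A] [MeasurableSpace B]
    [PseudoEMetricSpace A] [PseudoEMetricSpace B]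
    (θ : Measure ((A × B) × (A × B))) : ℝ≥0∞ :=
  ∫⁻ z, (edist z.1.1 z.2.1 ^ p + edist z.1.2 z.2.2 ^ p) ∂θ

/-- The (adapted) Wasserstein distance `W_{p,•}(π, π̃)` between couplings, with cost
`d_X^p + d_Y^p` and `X × Y` regarded as one path space. -/
def W2 {X Y : Fin N → Type*} [∀ t, MeasurableSpace (X t)] [∀ t, MeasurableSpace (Y t)]
    [∀ t, PseudoEMetricSpace (X t)] [∀ t, PseudoEMetricSpace (Y t)]
    (p : ℝ) (b : Flavor) (π ρ : Measure ((∀ t, X t) × (∀ t, Y t))) : ℝ≥0∞ :=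
  (⨅ θ : aCouplings2 b π ρ, lcost2 p θ.1) ^ (1 / p)

/- Relative entropy (Kullback-Leibler divergence): `D_KL(π, ρ) = ∫ log (dπ/dρ) dπ` if
`π ≪ ρ` and the integral is defined, and `∞` otherwise. -/
open Classical in
def KL {Ω : Type*} [MeasurableSpace Ω] (π ρ : Measure Ω) : ℝ≥0∞ :=
  if π ≪ ρ ∧ Integrable (llr π ρ) π then ENNReal.ofReal (∫ ω, llr π ρ ω ∂π) else ⊤

/-- The transport value `V_•(μ, ν, c)`. -/
def V {X Y : Fin N → Type*} [∀ t, MeasurableSpace (X t)] [∀ t, MeasurableSpace (Y t)]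
    (b : Flavor) (μ : Measure (∀ t, X t)) (ν : Measure (∀ t, Y t))
    (c : (∀ t, X t) × (∀ t, Y t) → ℝ) : ℝ :=
  ⨅ π : aCouplings b μ ν, ∫ z, c z ∂π.1

/-- The entropic objective `∫ c dπ + ε D_KL(π, P)`, valued in `EReal`. -/
def entObj {Ω : Type*} [MeasurableSpace Ω] (c : Ω → ℝ) (ε : ℝ) (P : Measure Ω)
    (π : Measure Ω) : EReal :=
  ((∫ z, c z ∂π : ℝ) : EReal) + (ε : EReal) * ((KL π P : ℝ≥0∞) : EReal)

/-- The entropic transport value `E_•^ε(μ, ν, c)`, valued in `EReal`. -/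
def EE {X Y : Fin N → Type*} [∀ t, MeasurableSpace (X t)] [∀ t, MeasurableSpace (Y t)]
    (b : Flavor) (μ : Measure (∀ t, X t)) (ν : Measure (∀ t, Y t))
    (c : (∀ t, X t) × (∀ t, Y t) → ℝ) (ε : ℝ) : EReal :=
  ⨅ π : aCouplings b μ ν, entObj c ε (μ.prod ν) π.1

/-- The kernel `K(x, y) := K^μ(x) ⊗ K^ν(y)` used to build the shadow. -/
def shadowKernel {A A' B B' : Type*} [MeasurableSpace A] [MeasurableSpace A']
    [MeasurableSpace B] [MeasurableSpace B']
    (Kμ : Kernel A A') (Kν : Kernel B B') : Kernel (A × B) (A' × B') :=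
  (Kμ.comap Prod.fst measurable_fst) ×ₖ (Kν.comap Prod.snd measurable_snd)

/-- The `(K^μ, K^ν)`-shadow of `π`: the second marginal of `π ⊗ (K^μ ⊗ K^ν)`. -/
def shadow {A A' B B' : Type*} [MeasurableSpace A] [MeasurableSpace A']
    [MeasurableSpace B] [MeasurableSpace B']
    (π : Measure (A × B)) (Kμ : Kernel A A') (Kν : Kernel B B') : Measure (A' × B') :=
  (π ⊗ₘ (shadowKernel Kμ Kν)).map Prod.snd

/-- `μ` has a finite `p`-th moment. -/
def MemPp {A : Type*} [MeasurableSpace A] [PseudoEMetricSpace A] (p : ℝ) (μ : Measure A) :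
    Prop :=
  ∀ x₀ : A, ∫⁻ x, edist x₀ x ^ p ∂μ ≠ ⊤

/-- `c` has growth of order at most `p`. -/
def GrowthLE {A B : Type*} [PseudoEMetricSpace A] [PseudoEMetricSpace B]
    (p : ℝ) (c : A × B → ℝ) : Prop :=
  ∃ (x₀ : A) (y₀ : B) (M : ℝ), ∀ z : A × B,
    |c z| ≤ M * (1 + (edist x₀ z.1).toReal ^ p + (edist y₀ z.2).toReal ^ p)

/-- Weak convergence of a sequence of measures (testing against bounded continuous
functions). -/
def WeakTendsto {A : Type*} [MeasurableSpace A] [TopologicalSpace A]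
    (πs : ℕ → Measure A) (π : Measure A) : Prop :=
  ∀ f : BoundedContinuousFunction A ℝ,
    Tendsto (fun n => ∫ x, f x ∂(πs n)) atTop (𝓝 (∫ x, f x ∂π))

/-- A finitely supported (discrete) measure. -/
def FinitelySupported {A : Type*} [MeasurableSpace A] (μ : Measure A) : Prop :=
  ∃ s : Finset A, μ (↑s)ᶜ = 0


/-- `K` is a version of the conditional distribution of the random element `V` given the
sub-σ-algebra `m`, under the measure `ρ`. -/
def IsCondDistrib' {Ω E : Type*} {mΩ : MeasurableSpace Ω} [MeasurableSpace E]
    (ρ : @Measure Ω mΩ) (V : Ω → E) (m : MeasurableSpace Ω) (K : Ω → Measure E) : Prop :=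
  (∀ ω, IsProbabilityMeasure (K ω)) ∧
  (∀ A : Set E, MeasurableSet A → Measurable[m] (fun ω => (K ω A).toReal)) ∧
  (∀ A : Set E, MeasurableSet A →
    (ρ[(V ⁻¹' A).indicator (fun _ => (1 : ℝ)) | m]) =ᵐ[ρ] fun ω => (K ω A).toReal)

/-- `Kμ` is a family of disintegration kernels of `μ` on a path space: `Kμ t` is a version of
the conditional distribution of the `t`-th coordinate given the past before `t`. -/
def IsDisintegration {X : Fin N → Type*} [∀ t, MeasurableSpace (X t)]
    (μ : Measure (∀ t, X t)) (Kμ : ∀ t : Fin N, (∀ s, X s) → Measure (X t)) : Prop :=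
  ∀ t : Fin N, IsCondDistrib' μ (fun x => x t) (pastσ X (t : ℕ)) (Kμ t)

variable {X Y : Fin N → Type*} [∀ t, MeasurableSpace (X t)] [∀ t, MeasurableSpace (Y t)]

open Classical in
/-- Membership in the dual building block `A_{X,μ,t}` (relative to a fixed family `Kμ` of
disintegration kernels of `μ`): for `t = 1` the bounded measurable functions of `x₁`; for
`t ≥ 2` functions `a_t(x_{1:t}, y_{1:t-1}) - ∫ a_t(x_{1:t-1}, x̃_t, y_{1:t-1}) μ_t^{x_{1:t-1}}(dx̃_t)`
with `a_t` bounded measurable. (Here `τ` is the 0-based coordinate index, `τ = t - 1`.) -/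
def MemAX (Kμ : ∀ t : Fin N, (∀ s, X s) → Measure (X t)) (τ : Fin N)
    (f : (∀ t, X t) × (∀ t, Y t) → ℝ) : Prop :=
  if (τ : ℕ) = 0 then
    ∃ a : (∀ t, X t) × (∀ t, Y t) → ℝ,
      Measurable[(coordσ X τ).comap Prod.fst] a ∧ (∃ M, ∀ ω, |a ω| ≤ M) ∧ f = a
  else
    ∃ a : (∀ t, X t) × (∀ t, Y t) → ℝ,
      Measurable[((pastσ X (τ : ℕ) ⊔ coordσ X τ).comap Prod.fst) ⊔
        ((pastσ Y (τ : ℕ)).comap Prod.snd)] a ∧ (∃ M, ∀ ω, |a ω| ≤ M) ∧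
      f = fun ω => a ω - ∫ x', a (Function.update ω.1 τ x', ω.2) ∂(Kμ τ ω.1)

open Classical in
/-- Membership in the dual building block `A_{Y,ν,t}` (symmetric to `MemAX`). -/
def MemAY (Kν : ∀ t : Fin N, (∀ s, Y s) → Measure (Y t)) (τ : Fin N)
    (f : (∀ t, X t) × (∀ t, Y t) → ℝ) : Prop :=
  if (τ : ℕ) = 0 then
    ∃ a : (∀ t, X t) × (∀ t, Y t) → ℝ,
      Measurable[(coordσ Y τ).comap Prod.snd] a ∧ (∃ M, ∀ ω, |a ω| ≤ M) ∧ f = a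
  else
    ∃ a : (∀ t, X t) × (∀ t, Y t) → ℝ,
      Measurable[((pastσ X (τ : ℕ)).comap Prod.fst) ⊔
        ((pastσ Y (τ : ℕ) ⊔ coordσ Y τ).comap Prod.snd)] a ∧ (∃ M, ∀ ω, |a ω| ≤ M) ∧
      f = fun ω => a ω - ∫ y', a (ω.1, Function.update ω.2 τ y') ∂(Kν τ ω.2)

/-- The dual space `S_{X,μ}`: sums `∑_{t=1}^N f_t` with `f_t ∈ A_{X,μ,t}`. -/
def MemSXμ (Kμ : ∀ t : Fin N, (∀ s, X s) → Measure (X t))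
    (s : (∀ t, X t) × (∀ t, Y t) → ℝ) : Prop :=
  ∃ f : Fin N → ((∀ t, X t) × (∀ t, Y t) → ℝ),
    (∀ τ, MemAX Kμ τ (f τ)) ∧ s = fun ω => ∑ τ, f τ ω

/-- The dual space `S_{Y,ν}`: sums `∑_{t=1}^N g_t` with `g_t ∈ A_{Y,ν,t}`. -/
def MemSYν (Kν : ∀ t : Fin N, (∀ s, Y s) → Measure (Y t))
    (s : (∀ t, X t) × (∀ t, Y t) → ℝ) : Prop :=
  ∃ g : Fin N → ((∀ t, X t) × (∀ t, Y t) → ℝ),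
    (∀ τ, MemAY Kν τ (g τ)) ∧ s = fun ω => ∑ τ, g τ ω

/-- The space `S_X` of bounded measurable functions depending only on `x`. -/
def MemSX (s : (∀ t, X t) × (∀ t, Y t) → ℝ) : Prop :=
  ∃ g : (∀ t, X t) → ℝ, Measurable g ∧ (∃ M, ∀ x, |g x| ≤ M) ∧ s = fun ω => g ω.1

/-- The space `S_Y` of bounded measurable functions depending only on `y`. -/
def MemSY (s : (∀ t, X t) × (∀ t, Y t) → ℝ) : Prop :=
  ∃ g : (∀ t, Y t) → ℝ, Measurable g ∧ (∃ M, ∀ y, |g y| ≤ M) ∧ s = fun ω => g ω.2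

/-- The dual space `H_•`: `H = S_X ⊕ S_Y`, `H_c = S_{X,μ} ⊕ S_Y`, `H_{ac} = S_X ⊕ S_{Y,ν}`,
`H_{bc} = S_{X,μ} ⊕ S_{Y,ν}`. -/
def MemH (Kμ : ∀ t : Fin N, (∀ s, X s) → Measure (X t))
    (Kν : ∀ t : Fin N, (∀ s, Y s) → Measure (Y t)) :
    Flavor → ((∀ t, X t) × (∀ t, Y t) → ℝ) → Prop
  | .plain => fun h => ∃ sX sY, MemSX (X := X) (Y := Y) sX ∧ MemSY sY ∧
      h = fun ω => sX ω + sY ω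
  | .causal => fun h => ∃ sX sY, MemSXμ Kμ sX ∧ MemSY sY ∧ h = fun ω => sX ω + sY ω
  | .anticausal => fun h => ∃ sX sY, MemSX (X := X) (Y := Y) sX ∧ MemSYν Kν sY ∧
      h = fun ω => sX ω + sY ω
  | .bicausal => fun h => ∃ sX sY, MemSXμ Kμ sX ∧ MemSYν Kν sY ∧ h = fun ω => sX ω + sY ω

/-- The set `Π_c(μ, ∗)` of causal measures with first marginal `μ` and arbitrary second
marginal. -/
def causalFirst (μ : Measure (∀ t, X t)) : Set (Measure ((∀ t, X t) × (∀ t, Y t))) :=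
  {π | π.map Prod.fst = μ ∧ IsCausal π}

/-- The set `Π(∗, ν)` of couplings with arbitrary first marginal and second marginal `ν`. -/
def secondMarg (ν : Measure (∀ t, Y t)) : Set (Measure ((∀ t, X t) × (∀ t, Y t))) :=
  {π | π.map Prod.snd = ν}

/-- The set `Π_{ac}(∗, ν)` of anticausal measures with second marginal `ν`. -/
def anticausalSecond (ν : Measure (∀ t, Y t)) : Set (Measure ((∀ t, X t) × (∀ t, Y t))) :=
  {π | π.map Prod.snd = ν ∧ IsAnticausal π}

/-- The reference measure `P_c` with `dP_c/dP = exp(-c)/∫ exp(-c) dP`. -/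
def Pc {Ω : Type*} [MeasurableSpace Ω] (P : Measure Ω) (c : Ω → ℝ) : Measure Ω :=
  P.withDensity
    (fun ω => ENNReal.ofReal (Real.exp (-c ω)) / ∫⁻ ω', ENNReal.ofReal (Real.exp (-c ω')) ∂P)

/-- Sinkhorn's algorithm: `full 0 = π0`; `half k` is the `D_KL`-projection of `full k`
onto `Q1`, and `full (k+1)` is the `D_KL`-projection of `half k` onto `Q2`. -/
structure IsSinkhorn {Ω : Type*} [MeasurableSpace Ω] (Q1 Q2 : Set (Measure Ω))
    (π0 : Measure Ω) (full half : ℕ → Measure Ω) : Prop where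
  init : full 0 = π0
  half_mem : ∀ k, half k ∈ Q1
  half_opt : ∀ k, ∀ ρ ∈ Q1, KL (half k) (full k) ≤ KL ρ (full k)
  full_mem : ∀ k, full (k + 1) ∈ Q2
  full_opt : ∀ k, ∀ ρ ∈ Q2, KL (full (k + 1)) (half k) ≤ KL ρ (half k)

/-- The second projection set of Sinkhorn's algorithm: `Π(∗, ν)` for the causal problem and
`Π_{ac}(∗, ν)` for the bicausal problem. -/
def sinkQ2 (b : Flavor) (ν : Measure (∀ t, Y t)) : Set (Measure ((∀ t, X t) × (∀ t, Y t))) :=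
  match b with
  | .bicausal => anticausalSecond ν
  | _ => secondMarg ν

/-- The dual class of the second Sinkhorn potential: `S_Y` for the causal problem,
`S_{Y,ν}` for the bicausal problem. -/
def MemG (Kν : ∀ t : Fin N, (∀ s, Y s) → Measure (Y t)) :
    Flavor → ((∀ t, X t) × (∀ t, Y t) → ℝ) → Prop
  | .bicausal => fun g => MemSYν Kν g
  | _ => fun g => MemSY g

/-- Real-valued entropic transport value (`ε = 1`), the infimum being taken over couplings
with finite relative entropy. -/
def Efin (b : Flavor) (μ : Measure (∀ t, X t)) (ν : Measure (∀ t, Y t))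
    (c : (∀ t, X t) × (∀ t, Y t) → ℝ) : ℝ :=
  ⨅ π : {π : Measure ((∀ t, X t) × (∀ t, Y t)) //
      π ∈ aCouplings b μ ν ∧ KL π (μ.prod ν) ≠ ⊤},
    (∫ z, c z ∂π.1 + (KL π.1 (μ.prod ν)).toReal)

section CondIndep

lemma setIntegral_eq_of_generateFrom {Ω : Type*} {m mΩ : MeasurableSpace Ω} {P : Measure Ω}
    {S : Set (Set Ω)} (hm : m ≤ mΩ) (hgen : m = MeasurableSpace.generateFrom S)
    (hS : IsPiSystem S) {f g : Ω → ℝ} (hf : Integrable f P) (hg : Integrable g P)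
    (htot : ∫ x, f x ∂P = ∫ x, g x ∂P)
    (h : ∀ s ∈ S, ∫ x in s, f x ∂P = ∫ x in s, g x ∂P) (s : Set Ω) (hs : MeasurableSet[m] s) :
    ∫ x in s, f x ∂P = ∫ x in s, g x ∂P := by
  induction s, hs using MeasurableSpace.induction_on_inter hgen hS with
  | empty => simp
  | basic t ht => exact h t ht
  | compl t ht ih =>
    have h1 := integral_add_compl (hm _ ht) hf
    have h2 := integral_add_compl (hm _ ht) hg
    linarith
  | iUnion u hd hu ih =>
    rw [integral_iUnion (fun i => hm _ (hu i)) hd hf.integrableOn,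
      integral_iUnion (fun i => hm _ (hu i)) hd hg.integrableOn]
    exact tsum_congr ih

lemma sup_eq_generateFrom_inter {Ω : Type*} (m₂ m₃ : MeasurableSpace Ω) :
    m₂ ⊔ m₃ = MeasurableSpace.generateFrom
      {D | ∃ B C, MeasurableSet[m₂] B ∧ MeasurableSet[m₃] C ∧ D = B ∩ C} := by
  apply le_antisymm
  · refine sup_le (fun B hB => ?_) (fun C hC => ?_)
    · exact MeasurableSpace.measurableSet_generateFrom
        ⟨B, univ, hB, @MeasurableSet.univ _ m₃, by simp⟩
    · exact MeasurableSpace.measurableSet_generateFrom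
        ⟨univ, C, @MeasurableSet.univ _ m₂, hC, by simp⟩
  · refine MeasurableSpace.generateFrom_le ?_
    rintro D ⟨B, C, hB, hC, rfl⟩
    exact @MeasurableSet.inter _ (m₂ ⊔ m₃) _ _ ((le_sup_left : m₂ ≤ m₂ ⊔ m₃) _ hB)
      ((le_sup_right : m₃ ≤ m₂ ⊔ m₃) _ hC)

lemma isPiSystem_inter {Ω : Type*} (m₂ m₃ : MeasurableSpace Ω) :
    IsPiSystem {D : Set Ω | ∃ B C, MeasurableSet[m₂] B ∧ MeasurableSet[m₃] C ∧ D = B ∩ C} := by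
  rintro _ ⟨B, C, hB, hC, rfl⟩ _ ⟨B', C', hB', hC', rfl⟩ -
  exact ⟨B ∩ B', C ∩ C', @MeasurableSet.inter _ m₂ _ _ hB hB',
    @MeasurableSet.inter _ m₃ _ _ hC hC', Set.inter_inter_inter_comm ..⟩

/-- Conditional independence of `m₁` and `m₂` given `m₃` in Doob's form: additional conditioning
on `m₂` does not change conditional probabilities of events in `m₁`. -/
def DoobIndep {Ω : Type*} (m₁ m₂ m₃ : MeasurableSpace Ω) {mΩ : MeasurableSpace Ω}
    (P : Measure Ω) : Prop :=
  ∀ A : Set Ω, MeasurableSet[m₁] A →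
    P[A.indicator (fun _ => (1 : ℝ)) | m₂ ⊔ m₃] =ᵐ[P] P[A.indicator (fun _ => (1 : ℝ)) | m₃]

variable {Ω : Type*} {m₁ m₂ m₃ m₄ mΩ : MeasurableSpace Ω} {P : Measure Ω} [IsProbabilityMeasure P]

lemma integrable_ind {A : Set Ω} (hA : MeasurableSet A) :
    Integrable (A.indicator (fun _ => (1 : ℝ))) P :=
  (integrable_const _).indicator hA

lemma doobIndep_of_setIntegral (h₁ : m₁ ≤ mΩ) (h₂ : m₂ ≤ mΩ) (h₃ : m₃ ≤ mΩ)
    (h : ∀ A, MeasurableSet[m₁] A → ∃ g : Ω → ℝ, StronglyMeasurable[m₃] g ∧ Integrable g P ∧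
      ∀ B C, MeasurableSet[m₂] B → MeasurableSet[m₃] C →
        ∫ x in B ∩ C, g x ∂P = P.real (A ∩ (B ∩ C))) :
    DoobIndep m₁ m₂ m₃ P := by
  intro A hA
  obtain ⟨g, hgm, hgi, hg⟩ := h A hA
  have hAi := integrable_ind (P := P) (h₁ _ hA)
  have key : ∀ D, MeasurableSet[m₂ ⊔ m₃] D →
      ∫ x in D, g x ∂P = ∫ x in D, A.indicator (fun _ => (1 : ℝ)) x ∂P := by
    have e : ∀ s, ∫ x in s, A.indicator (fun _ => (1 : ℝ)) x ∂P = P.real (A ∩ s) := by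
      intro s
      rw [integral_indicator (h₁ _ hA)]
      simp [measureReal_restrict_apply, h₁ _ hA]
    refine setIntegral_eq_of_generateFrom (sup_le h₂ h₃) (sup_eq_generateFrom_inter m₂ m₃)
      (isPiSystem_inter m₂ m₃) hgi hAi ?_ ?_
    · have := hg univ univ (@MeasurableSet.univ _ m₂) (@MeasurableSet.univ _ m₃)
      have h' := e univ
      simp only [Set.inter_univ, Measure.restrict_univ] at this h'
      rw [this, h']
    · rintro _ ⟨B, C, hB, hC, rfl⟩
      rw [hg B C hB hC, e]
  have a1 : g =ᵐ[P] P[A.indicator (fun _ => (1 : ℝ)) | m₂ ⊔ m₃] :=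
    ae_eq_condExp_of_forall_setIntegral_eq (sup_le h₂ h₃) hAi (fun _ _ _ => hgi.integrableOn)
      (fun s hs _ => key s hs)
      (hgm.mono (le_sup_right : m₃ ≤ m₂ ⊔ m₃)).aestronglyMeasurable
  have a2 : g =ᵐ[P] P[A.indicator (fun _ => (1 : ℝ)) | m₃] :=
    ae_eq_condExp_of_forall_setIntegral_eq h₃ hAi (fun _ _ _ => hgi.integrableOn)
      (fun s hs _ => key s ((le_sup_right : m₃ ≤ m₂ ⊔ m₃) _ hs)) hgm.aestronglyMeasurable
  exact a1.symm.trans a2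

lemma condIndepσ_iff_doobIndep (h₁ : m₁ ≤ mΩ) (h₂ : m₂ ≤ mΩ) (h₃ : m₃ ≤ mΩ) :
    CondIndepσ m₁ m₂ m₃ P ↔ DoobIndep m₁ m₂ m₃ P := by
  have mulind : ∀ A B : Set Ω, (A ∩ B).indicator (fun _ => (1 : ℝ)) =
      A.indicator (fun _ => (1 : ℝ)) * B.indicator (fun _ => (1 : ℝ)) := by
    intro A B; ext x; by_cases hA : x ∈ A <;> by_cases hB : x ∈ B <;> simp [hA, hB]
  constructor
  · intro h
    refine doobIndep_of_setIntegral h₁ h₂ h₃ fun A hA =>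
      ⟨P[A.indicator (fun _ => (1 : ℝ)) | m₃], stronglyMeasurable_condExp, integrable_condExp, ?_⟩
    intro B C hB hC
    set G := P[A.indicator (fun _ => (1 : ℝ)) | m₃] with hG
    have hBi := integrable_ind (P := P) (h₂ _ hB)
    have hGB : Integrable (G * B.indicator (fun _ => (1 : ℝ))) P := by
      have : G * B.indicator (fun _ => (1 : ℝ)) = B.indicator G := by
        ext x; by_cases hx : x ∈ B <;> simp [hx]
      rw [this]
      exact integrable_condExp.indicator (h₂ _ hB)
    have s1 : ∫ x in B ∩ C, G x ∂P = ∫ x in C, (G * B.indicator (fun _ => (1 : ℝ))) x ∂P := by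
      have : G * B.indicator (fun _ => (1 : ℝ)) = B.indicator G := by
        ext x; by_cases hx : x ∈ B <;> simp [hx]
      rw [this, setIntegral_indicator (h₂ _ hB), Set.inter_comm]
    have s2 : P[G * B.indicator (fun _ => (1 : ℝ)) | m₃] =ᵐ[P]
        G * P[B.indicator (fun _ => (1 : ℝ)) | m₃] :=
      condExp_mul_of_stronglyMeasurable_left stronglyMeasurable_condExp hGB hBi
    rw [s1, ← setIntegral_condExp h₃ hGB hC, integral_congr_ae (ae_restrict_of_ae
      (s2.trans (h A B hA hB).symm)), setIntegral_condExp h₃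
        (integrable_ind ((h₁ _ hA).inter (h₂ _ hB))) hC,
      integral_indicator ((h₁ _ hA).inter (h₂ _ hB))]
    simp only [integral_const, smul_eq_mul, mul_one]
    rw [measureReal_restrict_apply MeasurableSet.univ, Set.univ_inter,
      measureReal_restrict_apply ((h₁ _ hA).inter (h₂ _ hB)), Set.inter_assoc]
  · intro h A B hA hB
    have hAi := integrable_ind (P := P) (h₁ _ hA)
    have hBi := integrable_ind (P := P) (h₂ _ hB)
    have hABi := integrable_ind (P := P) ((h₁ _ hA).inter (h₂ _ hB))
    have hBm : StronglyMeasurable[m₂ ⊔ m₃] (B.indicator (fun _ => (1 : ℝ))) :=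
      StronglyMeasurable.indicator (@stronglyMeasurable_const _ _ (m₂ ⊔ m₃) _ _)
        ((le_sup_left : m₂ ≤ m₂ ⊔ m₃) _ hB)
    have t1 : P[(A ∩ B).indicator (fun _ => (1 : ℝ)) | m₂ ⊔ m₃] =ᵐ[P]
        P[A.indicator (fun _ => (1 : ℝ)) | m₂ ⊔ m₃] * B.indicator (fun _ => (1 : ℝ)) := by
      rw [mulind]
      refine condExp_mul_of_stronglyMeasurable_right hBm ?_ hAi
      rw [← mulind]; exact hABi
    have t2 : P[(A ∩ B).indicator (fun _ => (1 : ℝ)) | m₂ ⊔ m₃] =ᵐ[P]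
        P[A.indicator (fun _ => (1 : ℝ)) | m₃] * B.indicator (fun _ => (1 : ℝ)) :=
      t1.trans ((h A hA).mul (ae_eq_refl _))
    have hGB : Integrable (P[A.indicator (fun _ => (1 : ℝ)) | m₃] *
        B.indicator (fun _ => (1 : ℝ))) P := integrable_condExp.congr t2
    calc P[(A ∩ B).indicator (fun _ => (1 : ℝ)) | m₃]
        =ᵐ[P] P[P[(A ∩ B).indicator (fun _ => (1 : ℝ)) | m₂ ⊔ m₃] | m₃] :=
          (condExp_condExp_of_le le_sup_right (sup_le h₂ h₃)).symm
      _ =ᵐ[P] P[P[A.indicator (fun _ => (1 : ℝ)) | m₃] * B.indicator (fun _ => (1 : ℝ)) | m₃] :=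
          condExp_congr_ae t2
      _ =ᵐ[P] _ := condExp_mul_of_stronglyMeasurable_left stronglyMeasurable_condExp hGB hBi

lemma DoobIndep.symm (h₁ : m₁ ≤ mΩ) (h₂ : m₂ ≤ mΩ) (h₃ : m₃ ≤ mΩ)
    (h : DoobIndep m₁ m₂ m₃ P) : DoobIndep m₂ m₁ m₃ P := by
  rw [← condIndepσ_iff_doobIndep h₂ h₁ h₃]
  rw [← condIndepσ_iff_doobIndep h₁ h₂ h₃] at h
  intro A B hA hB
  rw [Set.inter_comm, mul_comm]
  exact h B A hB hA

omit [IsProbabilityMeasure P] in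
lemma DoobIndep.mono_left {m₁' : MeasurableSpace Ω} (h : DoobIndep m₁ m₂ m₃ P) (hle : m₁' ≤ m₁) :
    DoobIndep m₁' m₂ m₃ P := fun A hA => h A (hle _ hA)

/-- Decomposition. -/
lemma DoobIndep.mono_right {m₂' : MeasurableSpace Ω} (h : DoobIndep m₁ m₂ m₃ P)
    (h₂ : m₂ ≤ mΩ) (h₃ : m₃ ≤ mΩ) (hle : m₂' ≤ m₂) :
    DoobIndep m₁ m₂' m₃ P := fun A hA =>
  calc P[A.indicator (fun _ => (1 : ℝ)) | m₂' ⊔ m₃]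
      =ᵐ[P] P[P[A.indicator (fun _ => (1 : ℝ)) | m₂ ⊔ m₃] | m₂' ⊔ m₃] :=
        (condExp_condExp_of_le (sup_le_sup_right hle _) (sup_le h₂ h₃)).symm
    _ =ᵐ[P] P[P[A.indicator (fun _ => (1 : ℝ)) | m₃] | m₂' ⊔ m₃] := condExp_congr_ae (h A hA)
    _ =ᵐ[P] P[A.indicator (fun _ => (1 : ℝ)) | m₃] := by
        rw [condExp_of_stronglyMeasurable ((sup_le (hle.trans h₂) h₃))
          (stronglyMeasurable_condExp.mono le_sup_right) integrable_condExp]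

omit [IsProbabilityMeasure P] in
/-- Contraction. -/
lemma DoobIndep.contraction (h : DoobIndep m₁ m₂ m₃ P) (h' : DoobIndep m₁ m₄ (m₂ ⊔ m₃) P) :
    DoobIndep m₁ (m₄ ⊔ m₂) m₃ P := by
  intro A hA
  have := (h' A hA).trans (h A hA)
  rwa [← sup_assoc] at this

/-- Weak union. -/
lemma DoobIndep.weak_union (h : DoobIndep m₁ (m₄ ⊔ m₂) m₃ P) (h₂ : m₂ ≤ mΩ) (h₃ : m₃ ≤ mΩ)
    (h₄ : m₄ ≤ mΩ) : DoobIndep m₁ m₄ (m₂ ⊔ m₃) P := by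
  intro A hA
  have a := h A hA
  have b := h.mono_right (sup_le h₄ h₂) h₃ le_sup_right A hA
  rw [sup_assoc] at a
  exact a.trans b.symm

lemma condExp_map_comp {Ω' : Type*} {m' mΩ' : MeasurableSpace Ω'} {f : Ω → Ω'} (hf : Measurable f)
    (hm' : m' ≤ mΩ') {g : Ω' → ℝ} (hg : Integrable g (P.map f)) :
    (P.map f)[g | m'] ∘ f =ᵐ[P] P[g ∘ f | m'.comap f] := by
  have : IsProbabilityMeasure (P.map f) := Measure.isProbabilityMeasure_map hf.aemeasurable
  have hle : m'.comap f ≤ mΩ := (MeasurableSpace.comap_mono hm').trans hf.comap_le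
  have hsm : StronglyMeasurable[m'.comap f] ((P.map f)[g | m'] ∘ f) :=
    stronglyMeasurable_condExp.comp_measurable (comap_measurable f)
  have hi : Integrable ((P.map f)[g | m'] ∘ f) P :=
    Integrable.comp_measurable integrable_condExp hf
  refine ae_eq_condExp_of_forall_setIntegral_eq hle (hg.comp_measurable hf)
    (fun _ _ _ => hi.integrableOn) ?_ hsm.aestronglyMeasurable
  rintro _ ⟨s, hs, rfl⟩ -
  have := setIntegral_condExp hm' hg hs
  rw [setIntegral_map (hm' _ hs) integrable_condExp.aestronglyMeasurable hf.aemeasurable,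
    setIntegral_map (hm' _ hs) hg.aestronglyMeasurable hf.aemeasurable] at this
  exact this

lemma doobIndep_map_iff {Ω' : Type*} {n₁ n₂ n₃ mΩ' : MeasurableSpace Ω'} {f : Ω → Ω'}
    (hf : Measurable f) (h₁ : n₁ ≤ mΩ') (h₂ : n₂ ≤ mΩ') (h₃ : n₃ ≤ mΩ') :
    DoobIndep n₁ n₂ n₃ (P.map f) ↔ DoobIndep (n₁.comap f) (n₂.comap f) (n₃.comap f) P := by
  have : IsProbabilityMeasure (P.map f) := Measure.isProbabilityMeasure_map hf.aemeasurable
  have key : ∀ A, MeasurableSet[n₁] A →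
      ((P.map f)[A.indicator (fun _ => (1 : ℝ)) | n₂ ⊔ n₃] =ᵐ[P.map f]
        (P.map f)[A.indicator (fun _ => (1 : ℝ)) | n₃] ↔
      P[(f ⁻¹' A).indicator (fun _ => (1 : ℝ)) | n₂.comap f ⊔ n₃.comap f] =ᵐ[P]
        P[(f ⁻¹' A).indicator (fun _ => (1 : ℝ)) | n₃.comap f]) := by
    intro A hA
    have e1 := condExp_map_comp (P := P) hf (sup_le h₂ h₃) (integrable_ind (h₁ _ hA))
    have e2 := condExp_map_comp (P := P) hf h₃ (integrable_ind (h₁ _ hA))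
    rw [MeasurableSpace.comap_sup] at e1
    have hms : MeasurableSet {x | ((P.map f)[A.indicator (fun _ => (1 : ℝ)) | n₂ ⊔ n₃]) x =
        ((P.map f)[A.indicator (fun _ => (1 : ℝ)) | n₃]) x} :=
      measurableSet_eq_fun (stronglyMeasurable_condExp.mono (sup_le h₂ h₃)).measurable
        (stronglyMeasurable_condExp.mono h₃).measurable
    have e0 : (f ⁻¹' A).indicator (fun _ => (1 : ℝ)) = A.indicator (fun _ => (1 : ℝ)) ∘ f := rfl
    rw [e0]
    constructor
    · intro h
      have h' : (P.map f)[A.indicator (fun _ => (1 : ℝ)) | n₂ ⊔ n₃] ∘ f =ᵐ[P]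
          (P.map f)[A.indicator (fun _ => (1 : ℝ)) | n₃] ∘ f := ae_of_ae_map hf.aemeasurable h
      exact e1.symm.trans (h'.trans e2)
    · intro h
      exact (ae_map_iff hf.aemeasurable hms).2 (e1.trans (h.trans e2.symm))
  constructor
  · rintro h _ ⟨A, hA, rfl⟩
    exact (key A hA).1 (h A hA)
  · intro h A hA
    exact (key A hA).2 (h _ ⟨A, hA, rfl⟩)

end CondIndep

section CausalTransfer

lemma pastσOf_le {A : Type*} {mA : MeasurableSpace A} {m : Fin N → MeasurableSpace A}
    (hm : ∀ t, m t ≤ mA) (t : ℕ) : pastσOf m t ≤ mA :=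
  iSup_le fun s => iSup_le fun _ => hm s

lemma pastσOf_mono {A : Type*} (m : Fin N → MeasurableSpace A) {s t : ℕ} (h : s ≤ t) :
    pastσOf m s ≤ pastσOf m t :=
  iSup_le fun r => iSup_le fun hr => le_iSup₂_of_le r (hr.trans_le h) le_rfl

lemma le_pastσOf {A : Type*} (m : Fin N → MeasurableSpace A) (s : Fin N) {t : ℕ}
    (h : (s : ℕ) < t) : m s ≤ pastσOf m t :=
  le_iSup₂_of_le s h le_rfl

lemma pastσOf_succ {A : Type*} (m : Fin N → MeasurableSpace A) (t : Fin N) :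
    pastσOf m (t + 1) = m t ⊔ pastσOf m t := by
  apply le_antisymm
  · refine iSup_le fun s => iSup_le fun hs => ?_
    rcases Nat.lt_succ_iff_lt_or_eq.1 hs with h | h
    · exact (le_pastσOf m s h).trans le_sup_right
    · rw [Fin.ext h]; exact le_sup_left
  · exact sup_le (le_pastσOf m t (Nat.lt_succ_self _)) (pastσOf_mono m (Nat.le_succ _))

lemma comap_pastσOf {A B : Type*} (m : Fin N → MeasurableSpace A) (f : B → A) (t : ℕ) :
    (pastσOf m t).comap f = pastσOf (fun s => (m s).comap f) t := by
  simp only [pastσOf, MeasurableSpace.comap_iSup]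

lemma coordσ_le (X : Fin N → Type*) [∀ t, MeasurableSpace (X t)] (t : Fin N) :
    coordσ X t ≤ MeasurableSpace.pi :=
  (measurable_pi_apply t).comap_le

variable {Ω A B : Type*} {mΩ : MeasurableSpace Ω} [mA : MeasurableSpace A] [mB : MeasurableSpace B]
  {P : Measure Ω} [IsProbabilityMeasure P]

lemma isCausalFor_map_iff {m : Fin N → MeasurableSpace A} {n : Fin N → MeasurableSpace B}
    (hm : ∀ t, m t ≤ mA) (hn : ∀ t, n t ≤ mB) {f : Ω → A × B} (hf : Measurable f) :
    IsCausalFor m n (P.map f) ↔ ∀ t : Fin N, DoobIndep ((m t).comap fun ω => (f ω).1)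
      (pastσOf (fun s => (n s).comap fun ω => (f ω).2) t)
      (pastσOf (fun s => (m s).comap fun ω => (f ω).1) t) P := by
  have : IsProbabilityMeasure (P.map f) := Measure.isProbabilityMeasure_map hf.aemeasurable
  refine forall_congr' fun t => ?_
  have h1 : (m t).comap Prod.fst ≤ (inferInstance : MeasurableSpace (A × B)) :=
    (MeasurableSpace.comap_mono (hm t)).trans measurable_fst.comap_le
  have h2 : (pastσOf n t).comap Prod.snd ≤ (inferInstance : MeasurableSpace (A × B)) :=
    (MeasurableSpace.comap_mono (pastσOf_le hn t)).trans measurable_snd.comap_le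
  have h3 : (pastσOf m t).comap Prod.fst ≤ (inferInstance : MeasurableSpace (A × B)) :=
    (MeasurableSpace.comap_mono (pastσOf_le hm t)).trans measurable_fst.comap_le
  rw [condIndepσ_iff_doobIndep h1 h2 h3, doobIndep_map_iff hf h1 h2 h3]
  simp only [comap_pastσOf, MeasurableSpace.comap_comp]
  rfl

lemma isAnticausalFor_map_iff {m : Fin N → MeasurableSpace A} {n : Fin N → MeasurableSpace B}
    (hm : ∀ t, m t ≤ mA) (hn : ∀ t, n t ≤ mB) {f : Ω → A × B} (hf : Measurable f) :
    IsAnticausalFor m n (P.map f) ↔ ∀ t : Fin N, DoobIndep ((n t).comap fun ω => (f ω).2)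
      (pastσOf (fun s => (m s).comap fun ω => (f ω).1) t)
      (pastσOf (fun s => (n s).comap fun ω => (f ω).2) t) P := by
  rw [IsAnticausalFor, Measure.map_map measurable_swap hf,
    isCausalFor_map_iff hn hm (measurable_swap.comp hf)]
  rfl

end CausalTransfer

section Graphoid

variable {Ω : Type*} {mΩ : MeasurableSpace Ω} {P : Measure Ω} [IsProbabilityMeasure P]

/-- One-step causality implies that the past of the second process is independent of the whole
first process given the past of the first process. -/
lemma doobIndep_past {mX mY : Fin N → MeasurableSpace Ω} (hX : ∀ t, mX t ≤ mΩ)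
    (hY : ∀ t, mY t ≤ mΩ)
    (h : ∀ t : Fin N, DoobIndep (mX t) (pastσOf mY t) (pastσOf mX t) P) (t k : ℕ) (htk : t ≤ k)
    (hk : k ≤ N) : DoobIndep (pastσOf mY t) (pastσOf mX k) (pastσOf mX t) P := by
  induction k, htk using Nat.le_induction with
  | base => intro A _; rw [sup_idem]
  | succ k htk ih =>
    have h1 := ih (by omega)
    have h2 := ((h ⟨k, hk⟩).symm (hX _) (pastσOf_le hY _) (pastσOf_le hX _)).mono_left
      (pastσOf_mono mY htk)
    have e : pastσOf mX k ⊔ pastσOf mX t = pastσOf mX k := sup_eq_left.2 (pastσOf_mono mX htk)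
    have h3 := h1.contraction (m₄ := mX ⟨k, hk⟩) (by rw [e]; exact h2)
    rwa [← pastσOf_succ mX ⟨k, hk⟩] at h3

lemma doobIndep_shadow {mX mY mX' mY' : Fin N → MeasurableSpace Ω} (hX : ∀ t, mX t ≤ mΩ)
    (hY : ∀ t, mY t ≤ mΩ) (hX' : ∀ t, mX' t ≤ mΩ) (hY' : ∀ t, mY' t ≤ mΩ)
    (hγ : ∀ t : Fin N, DoobIndep (mX' t) (pastσOf mX t) (pastσOf mX' t) P)
    (hπ : ∀ t : Fin N, DoobIndep (mX t) (pastσOf mY t) (pastσOf mX t) P)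
    (hη : ∀ t : Fin N, DoobIndep (mY t) (pastσOf mY' t) (pastσOf mY t) P)
    (hXX : DoobIndep (pastσOf mX' N) (pastσOf mY N) (pastσOf mX N) P)
    (hYY : DoobIndep (pastσOf mY' N) (pastσOf mX N ⊔ pastσOf mX' N) (pastσOf mY N) P)
    (t : Fin N) : DoobIndep (mX' t) (pastσOf mY' t) (pastσOf mX' t) P := by
  have ht : (t : ℕ) ≤ N := t.2.le
  have lX := pastσOf_le hX
  have lY := pastσOf_le hY
  have lX' := pastσOf_le hX'
  have lY' := pastσOf_le hY'
  have a := doobIndep_past hX hY hπ t N ht le_rfl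
  have b := doobIndep_past hY hY' hη t N ht le_rfl
  have s1 : DoobIndep (pastσOf mY t) (pastσOf mX' N ⊔ pastσOf mX N) (pastσOf mX t) P := by
    refine a.contraction ?_
    rw [sup_eq_left.2 (pastσOf_mono mX ht)]
    exact (hXX.symm (lX' _) (lY _) (lX _)).mono_left (pastσOf_mono mY ht)
  have s2 : DoobIndep (pastσOf mY' t) ((pastσOf mX' N ⊔ pastσOf mX N) ⊔ pastσOf mY N)
      (pastσOf mY t) P := by
    refine b.contraction ?_
    rw [sup_eq_left.2 (pastσOf_mono mY ht), sup_comm]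
    exact hYY.mono_left (pastσOf_mono mY' ht)
  have lXX : pastσOf mX' N ⊔ pastσOf mX N ≤ mΩ := sup_le (lX' _) (lX _)
  have s3 : DoobIndep (pastσOf mY' t) (pastσOf mX' N ⊔ pastσOf mX N)
      (pastσOf mX t ⊔ pastσOf mY t) P := by
    refine DoobIndep.weak_union ?_ (lX _) (lY _) lXX
    refine s2.mono_right (sup_le lXX (lY _)) (lY _) (sup_le le_sup_left ?_)
    exact (pastσOf_mono mX ht).trans (le_sup_right.trans le_sup_left)
  have s4 : DoobIndep (pastσOf mX' N ⊔ pastσOf mX N) (pastσOf mY' t) (pastσOf mX t) P := by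
    refine DoobIndep.mono_right (m₂ := pastσOf mY' t ⊔ pastσOf mY t) ?_
      (sup_le (lY' _) (lY _)) (lX _) le_sup_left
    refine (s1.symm (lY _) lXX (lX _)).contraction ?_
    rw [sup_comm (pastσOf mY t)]
    exact s3.symm (lY' _) lXX (sup_le (lX _) (lY _))
  have s5 : DoobIndep (mX' t) (pastσOf mY' t) (pastσOf mX' t ⊔ pastσOf mX t) P := by
    refine DoobIndep.symm (lY' _) (hX' _) (sup_le (lX' _) (lX _)) ?_
    refine DoobIndep.weak_union ?_ (lX' _) (lX _) (hX' _)
    refine (s4.symm lXX (lY' _) (lX _)).mono_right lXX (lX _) (le_trans ?_ le_sup_left)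
    exact sup_le (le_pastσOf mX' t t.2) (pastσOf_mono mX' ht)
  refine DoobIndep.mono_right (m₂ := pastσOf mY' t ⊔ pastσOf mX t) ?_
    (sup_le (lY' _) (lX _)) (lX' _) le_sup_left
  refine (hγ t).contraction ?_
  rwa [sup_comm (pastσOf mX t)]

end Graphoid

section Shadow

variable {A B A' B' : Type*} [MeasurableSpace A] [MeasurableSpace B] [MeasurableSpace A']
  [MeasurableSpace B'] (π : Measure (A × B)) [IsProbabilityMeasure π]
  (κ : Kernel A A') [IsMarkovKernel κ] (η : Kernel B B') [IsMarkovKernel η]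

lemma map_compProd_parallelComp_left :
    (π ⊗ₘ (κ ∥ₖ η)).map (fun ω => (ω.1.1, ω.2.1)) = (π.map Prod.fst) ⊗ₘ κ := by
  have : IsProbabilityMeasure (π.map Prod.fst) :=
    Measure.isProbabilityMeasure_map measurable_fst.aemeasurable
  ext s hs
  rw [Measure.map_apply (by fun_prop) hs, Measure.compProd_apply (hs.preimage (by fun_prop)),
    Measure.compProd_apply hs, lintegral_map (Kernel.measurable_kernel_prodMk_left hs)
      measurable_fst]
  refine lintegral_congr fun z => ?_
  have e : Prod.mk z ⁻¹' ((fun ω : (A × B) × (A' × B') => (ω.1.1, ω.2.1)) ⁻¹' s) =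
      (Prod.mk z.1 ⁻¹' s) ×ˢ univ := by ext; simp
  rw [e, Kernel.parallelComp_apply_prod]
  simp

lemma map_compProd_parallelComp_swap :
    (π ⊗ₘ (κ ∥ₖ η)).map (Prod.map Prod.swap Prod.swap) = (π.map Prod.swap) ⊗ₘ (η ∥ₖ κ) := by
  have : IsProbabilityMeasure (π.map Prod.swap) :=
    Measure.isProbabilityMeasure_map measurable_swap.aemeasurable
  have hm : Measurable (Prod.map Prod.swap Prod.swap : (A × B) × (A' × B') → _) :=
    measurable_swap.prodMap measurable_swap
  ext s hs
  rw [Measure.map_apply hm hs, Measure.compProd_apply (hs.preimage hm),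
    Measure.compProd_apply hs, lintegral_map (Kernel.measurable_kernel_prodMk_left hs)
      measurable_swap]
  refine lintegral_congr fun z => ?_
  rw [Kernel.parallelComp_apply, Kernel.parallelComp_apply, Prod.fst_swap, Prod.snd_swap,
    ← Measure.prod_swap, Measure.map_apply measurable_swap
      (measurable_prodMk_left (hs.preimage hm))]
  rfl

lemma map_compProd_parallelComp_right :
    (π ⊗ₘ (κ ∥ₖ η)).map (fun ω => (ω.1.2, ω.2.2)) = (π.map Prod.snd) ⊗ₘ η := by
  have : IsProbabilityMeasure (π.map Prod.swap) :=
    Measure.isProbabilityMeasure_map measurable_swap.aemeasurable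
  have h := map_compProd_parallelComp_left (π.map Prod.swap) η κ
  rw [← map_compProd_parallelComp_swap, Measure.map_map (by fun_prop)
    (measurable_swap.prodMap measurable_swap), Measure.map_map measurable_fst measurable_swap] at h
  exact h

lemma doobIndep_compProd_parallelComp_left :
    DoobIndep (MeasurableSpace.comap (fun ω : (A × B) × (A' × B') => ω.2.1) inferInstance)
      (MeasurableSpace.comap (fun ω : (A × B) × (A' × B') => (ω.1.2, ω.2.2)) inferInstance)
      (MeasurableSpace.comap (fun ω : (A × B) × (A' × B') => ω.1.1) inferInstance)
      (π ⊗ₘ (κ ∥ₖ η)) := by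
  refine doobIndep_of_setIntegral (Measurable.comap_le (by fun_prop))
    (Measurable.comap_le (by fun_prop)) (Measurable.comap_le (by fun_prop)) ?_
  rintro _ ⟨E, hE, rfl⟩
  have hk : Measurable fun ω : (A × B) × (A' × B') => κ ω.1.1 E :=
    (κ.measurable_coe hE).comp (by fun_prop)
  refine ⟨fun ω => (κ ω.1.1 E).toReal, ?_, ?_, ?_⟩
  · exact (((κ.measurable_coe hE).ennreal_toReal).comp
      (comap_measurable (fun ω : (A × B) × (A' × B') => ω.1.1))).stronglyMeasurable
  · refine Integrable.of_bound hk.ennreal_toReal.aestronglyMeasurable 1 (ae_of_all _ fun ω => ?_)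
    rw [Real.norm_eq_abs, abs_of_nonneg ENNReal.toReal_nonneg]
    exact measureReal_le_one
  · rintro _ _ ⟨F, hF, rfl⟩ ⟨G, hG, rfl⟩
    rw [integral_toReal hk.aemeasurable (ae_of_all _ fun ω => measure_lt_top _ _), Measure.real]
    congr 1
    have hF' : MeasurableSet ((fun ω : (A × B) × (A' × B') => (ω.1.2, ω.2.2)) ⁻¹' F) :=
      hF.preimage (by fun_prop)
    have hG' : MeasurableSet ((fun ω : (A × B) × (A' × B') => ω.1.1) ⁻¹' G) :=
      hG.preimage (by fun_prop)
    have hE' : MeasurableSet ((fun ω : (A × B) × (A' × B') => ω.2.1) ⁻¹' E) :=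
      hE.preimage (by fun_prop)
    rw [← lintegral_indicator (hF'.inter hG'), Measure.lintegral_compProd
      (hk.indicator (hF'.inter hG')), Measure.compProd_apply (hE'.inter (hF'.inter hG'))]
    refine lintegral_congr fun z => ?_
    by_cases hz : z.1 ∈ G
    · have e1 : Prod.mk z ⁻¹' ((fun ω : (A × B) × (A' × B') => ω.2.1) ⁻¹' E ∩
          ((fun ω => (ω.1.2, ω.2.2)) ⁻¹' F ∩ (fun ω => ω.1.1) ⁻¹' G)) =
          E ×ˢ (Prod.mk z.2 ⁻¹' F) := by
        ext w; simp [hz]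
      have e2 : (fun w => ((fun ω : (A × B) × (A' × B') => (ω.1.2, ω.2.2)) ⁻¹' F ∩
          (fun ω => ω.1.1) ⁻¹' G).indicator (fun ω => κ ω.1.1 E) (z, w)) =
          ((univ : Set A') ×ˢ (Prod.mk z.2 ⁻¹' F)).indicator (fun _ => κ z.1 E) := by
        ext w
        have h1 : (z, w) ∈ ((fun ω : (A × B) × (A' × B') => (ω.1.2, ω.2.2)) ⁻¹' F ∩
          (fun ω => ω.1.1) ⁻¹' G) ↔ (z.2, w.2) ∈ F := ⟨fun h => h.1, fun h => ⟨h, hz⟩⟩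
        have h2 : w ∈ (univ : Set A') ×ˢ (Prod.mk z.2 ⁻¹' F) ↔ (z.2, w.2) ∈ F :=
          ⟨fun h => h.2, fun h => ⟨mem_univ _, h⟩⟩
        by_cases hw : (z.2, w.2) ∈ F
        · exact (if_pos (h1.2 hw)).trans (if_pos (h2.2 hw)).symm
        · exact (if_neg fun h => hw (h1.1 h)).trans (if_neg fun h => hw (h2.1 h)).symm
      rw [e1, e2, lintegral_indicator_const (MeasurableSet.univ.prod (measurable_prodMk_left hF)),
        Kernel.parallelComp_apply_prod, Kernel.parallelComp_apply_prod]
      simp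
    · have e1 : Prod.mk z ⁻¹' ((fun ω : (A × B) × (A' × B') => ω.2.1) ⁻¹' E ∩
          ((fun ω => (ω.1.2, ω.2.2)) ⁻¹' F ∩ (fun ω => ω.1.1) ⁻¹' G)) = ∅ := by
        ext w; simp [hz]
      rw [e1]
      simp [Set.indicator, hz]

lemma doobIndep_compProd_parallelComp_right :
    DoobIndep (MeasurableSpace.comap (fun ω : (A × B) × (A' × B') => ω.2.2) inferInstance)
      (MeasurableSpace.comap (fun ω : (A × B) × (A' × B') => (ω.1.1, ω.2.1)) inferInstance)
      (MeasurableSpace.comap (fun ω : (A × B) × (A' × B') => ω.1.2) inferInstance)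
      (π ⊗ₘ (κ ∥ₖ η)) := by
  have : IsProbabilityMeasure (π.map Prod.swap) :=
    Measure.isProbabilityMeasure_map measurable_swap.aemeasurable
  have h := doobIndep_compProd_parallelComp_left (π.map Prod.swap) η κ
  rw [← map_compProd_parallelComp_swap, doobIndep_map_iff
    (measurable_swap.prodMap measurable_swap) (Measurable.comap_le (by fun_prop))
    (Measurable.comap_le (by fun_prop)) (Measurable.comap_le (by fun_prop))] at h
  simp only [MeasurableSpace.comap_comp] at h
  exact h

end Shadow

section ShadowCoupling

lemma KL_eq_klDiv {Ω : Type*} [MeasurableSpace Ω] (π ρ : Measure Ω) [IsProbabilityMeasure π]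
    [IsProbabilityMeasure ρ] : KL π ρ = InformationTheory.klDiv π ρ := by
  rw [KL, InformationTheory.klDiv]
  simp

lemma comap_le_comap_prodMk_left {Ω A B : Type*} [MeasurableSpace A] [MeasurableSpace B]
    (f : Ω → A) (g : Ω → B) : MeasurableSpace.comap f inferInstance ≤
      MeasurableSpace.comap (fun ω => (f ω, g ω)) inferInstance := by
  rintro _ ⟨s, hs, rfl⟩
  exact ⟨Prod.fst ⁻¹' s, hs.preimage measurable_fst, rfl⟩

lemma comap_le_comap_prodMk_right {Ω A B : Type*} [MeasurableSpace A] [MeasurableSpace B]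
    (f : Ω → A) (g : Ω → B) : MeasurableSpace.comap g inferInstance ≤
      MeasurableSpace.comap (fun ω => (f ω, g ω)) inferInstance := by
  rintro _ ⟨s, hs, rfl⟩
  exact ⟨Prod.snd ⁻¹' s, hs.preimage measurable_snd, rfl⟩

variable {X Y : Fin N → Type*} [∀ t, MeasurableSpace (X t)] [∀ t, MeasurableSpace (Y t)]

omit [∀ t, MeasurableSpace (Y t)] in
lemma pastσOf_coordσ_last : pastσOf (coordσ X) N = MeasurableSpace.pi := by
  simp [pastσOf, coordσ, MeasurableSpace.pi]

omit [∀ t, MeasurableSpace (Y t)] in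
lemma comap_coordσ_le {B : Type*} {mB : MeasurableSpace B} {f : B → ∀ t, X t} (hf : Measurable f)
    (t : Fin N) : (coordσ X t).comap f ≤ mB :=
  (MeasurableSpace.comap_mono (coordσ_le X t)).trans hf.comap_le

lemma isCausal_shadow {π : Measure ((∀ t, X t) × (∀ t, Y t))} [IsProbabilityMeasure π]
    {κ : Kernel (∀ t, X t) (∀ t, X t)} [IsMarkovKernel κ] {η : Kernel (∀ t, Y t) (∀ t, Y t)}
    [IsMarkovKernel η] (hπ : IsCausal π) (hκ : IsAnticausal (π.map Prod.fst ⊗ₘ κ))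
    (hη : IsCausal (π.map Prod.snd ⊗ₘ η)) : IsCausal ((π ⊗ₘ (κ ∥ₖ η)).map Prod.snd) := by
  have e : π = (π ⊗ₘ (κ ∥ₖ η)).map Prod.fst := (Measure.fst_compProd _ _).symm
  rw [IsCausal, e, isCausalFor_map_iff (coordσ_le X) (coordσ_le Y) measurable_fst] at hπ
  rw [IsAnticausal, ← map_compProd_parallelComp_left π κ η,
    isAnticausalFor_map_iff (coordσ_le X) (coordσ_le X) (by fun_prop)] at hκ
  rw [IsCausal, ← map_compProd_parallelComp_right π κ η,
    isCausalFor_map_iff (coordσ_le Y) (coordσ_le Y) (by fun_prop)] at hη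
  rw [IsCausal, isCausalFor_map_iff (coordσ_le X) (coordσ_le Y) measurable_snd]
  have hl := doobIndep_compProd_parallelComp_left π κ η
  have hr := doobIndep_compProd_parallelComp_right π κ η
  have m1 : Measurable fun ω : ((∀ t, X t) × (∀ t, Y t)) × ((∀ t, X t) × (∀ t, Y t)) => ω.1.1 :=
    measurable_fst.fst
  have m2 : Measurable fun ω : ((∀ t, X t) × (∀ t, Y t)) × ((∀ t, X t) × (∀ t, Y t)) => ω.1.2 :=
    measurable_fst.snd
  have m3 : Measurable fun ω : ((∀ t, X t) × (∀ t, Y t)) × ((∀ t, X t) × (∀ t, Y t)) => ω.2.1 :=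
    measurable_snd.fst
  have m4 : Measurable fun ω : ((∀ t, X t) × (∀ t, Y t)) × ((∀ t, X t) × (∀ t, Y t)) => ω.2.2 :=
    measurable_snd.snd
  refine doobIndep_shadow (comap_coordσ_le m1) (comap_coordσ_le m2) (comap_coordσ_le m3)
    (comap_coordσ_le m4) hκ hπ hη ?_ ?_
  · rw [← comap_pastσOf, ← comap_pastσOf, ← comap_pastσOf, pastσOf_coordσ_last,
      pastσOf_coordσ_last]
    refine hl.mono_right (m2.prodMk m4).comap_le m1.comap_le ?_
    exact comap_le_comap_prodMk_left _ _
  · rw [← comap_pastσOf, ← comap_pastσOf, ← comap_pastσOf, ← comap_pastσOf, pastσOf_coordσ_last,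
      pastσOf_coordσ_last]
    refine hr.mono_right (m1.prodMk m3).comap_le m2.comap_le (sup_le ?_ ?_)
    · exact comap_le_comap_prodMk_left _ _
    · exact comap_le_comap_prodMk_right _ _

lemma isAnticausal_shadow {π : Measure ((∀ t, X t) × (∀ t, Y t))} [IsProbabilityMeasure π]
    {κ : Kernel (∀ t, X t) (∀ t, X t)} [IsMarkovKernel κ] {η : Kernel (∀ t, Y t) (∀ t, Y t)}
    [IsMarkovKernel η] (hπ : IsAnticausal π) (hκ : IsCausal (π.map Prod.fst ⊗ₘ κ))
    (hη : IsAnticausal (π.map Prod.snd ⊗ₘ η)) :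
    IsAnticausal ((π ⊗ₘ (κ ∥ₖ η)).map Prod.snd) := by
  have : IsProbabilityMeasure (π.map Prod.swap) :=
    Measure.isProbabilityMeasure_map measurable_swap.aemeasurable
  have h1 : (π.map Prod.swap).map Prod.fst = π.map Prod.snd :=
    Measure.map_map measurable_fst measurable_swap
  have h2 : (π.map Prod.swap).map Prod.snd = π.map Prod.fst :=
    Measure.map_map measurable_snd measurable_swap
  have h := isCausal_shadow (π := π.map Prod.swap) (κ := η) (η := κ) hπ (by rwa [h1])
    (by rwa [h2])
  rw [← map_compProd_parallelComp_swap, Measure.map_map measurable_snd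
    (measurable_swap.prodMap measurable_swap)] at h
  rwa [IsAnticausal, IsAnticausalFor, Measure.map_map measurable_swap measurable_snd]

lemma isProbabilityMeasure_of_map {A B : Type*} [MeasurableSpace A] [MeasurableSpace B]
    {π : Measure A} {f : A → B} (hf : Measurable f) {μ : Measure B} [IsProbabilityMeasure μ]
    (h : π.map f = μ) : IsProbabilityMeasure π := by
  constructor
  rw [← preimage_univ (f := f), ← Measure.map_apply hf MeasurableSet.univ, h, measure_univ]

lemma comp_prod_parallelComp {A B A' B' : Type*} [MeasurableSpace A] [MeasurableSpace B]
    [MeasurableSpace A'] [MeasurableSpace B'] (μ : Measure A) (ν : Measure B) [SFinite μ]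
    [SFinite ν] (κ : Kernel A A') [IsSFiniteKernel κ] (η : Kernel B B') [IsSFiniteKernel η] :
    (κ ∥ₖ η) ∘ₘ (μ.prod ν) = (κ ∘ₘ μ).prod (η ∘ₘ ν) := by
  rw [Measure.prod_comp_left, Measure.prod_comp_right, Measure.comp_assoc,
    Kernel.parallelComp_comp_parallelComp, Kernel.comp_id, Kernel.id_comp]

/-- Transporting an adapted coupling along bicausal couplings of the marginals. -/
lemma exists_shadow [∀ t, StandardBorelSpace (X t)] [∀ t, StandardBorelSpace (Y t)]
    [∀ t, PseudoEMetricSpace (X t)] [∀ t, OpensMeasurableSpace (X t)]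
    [∀ t, SecondCountableTopology (X t)]
    [∀ t, PseudoEMetricSpace (Y t)] [∀ t, OpensMeasurableSpace (Y t)]
    [∀ t, SecondCountableTopology (Y t)] {b : Flavor}
    {μ μ' : Measure (∀ t, X t)} {ν ν' : Measure (∀ t, Y t)}
    [IsProbabilityMeasure μ] [IsProbabilityMeasure μ'] [IsProbabilityMeasure ν]
    [IsProbabilityMeasure ν'] {π : Measure ((∀ t, X t) × (∀ t, Y t))}
    {γ : Measure ((∀ t, X t) × (∀ t, X t))} {η : Measure ((∀ t, Y t) × (∀ t, Y t))}
    (hπ : π ∈ aCouplings b μ ν) (hγ : γ ∈ aCouplings .bicausal μ μ')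
    (hη : η ∈ aCouplings .bicausal ν ν') :
    ∃ θ : Measure (((∀ t, X t) × (∀ t, Y t)) × ((∀ t, X t) × (∀ t, Y t))),
      θ.map Prod.fst = π ∧ θ.map Prod.snd ∈ aCouplings b μ' ν' ∧
      KL (θ.map Prod.snd) (μ'.prod ν') ≤ KL π (μ.prod ν) ∧
      ∀ p : ℝ, lcost2 p θ = lcost p γ + lcost p η := by
  obtain ⟨⟨hπ1, hπ2⟩, hπb⟩ := hπ
  obtain ⟨⟨hγ1, hγ2⟩, hγb⟩ := hγ
  obtain ⟨⟨hη1, hη2⟩, hηb⟩ := hη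
  have := isProbabilityMeasure_of_map measurable_fst hπ1
  have := isProbabilityMeasure_of_map measurable_fst hγ1
  have := isProbabilityMeasure_of_map measurable_fst hη1
  have : Nonempty (∀ t, X t) := nonempty_of_isProbabilityMeasure μ
  have : Nonempty (∀ t, Y t) := nonempty_of_isProbabilityMeasure ν
  have eγ : π.map Prod.fst ⊗ₘ γ.condKernel = γ := by
    rw [hπ1, ← hγ1]; exact γ.disintegrate γ.condKernel
  have eη : π.map Prod.snd ⊗ₘ η.condKernel = η := by
    rw [hπ2, ← hη1]; exact η.disintegrate η.condKernel
  have eγ' : μ ⊗ₘ γ.condKernel = γ := hπ1 ▸ eγ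
  have eη' : ν ⊗ₘ η.condKernel = η := hπ2 ▸ eη
  set θ := π ⊗ₘ (γ.condKernel ∥ₖ η.condKernel) with hθ
  have eX : θ.map (fun ω => (ω.1.1, ω.2.1)) = γ :=
    (map_compProd_parallelComp_left _ _ _).trans eγ
  have eY : θ.map (fun ω => (ω.1.2, ω.2.2)) = η :=
    (map_compProd_parallelComp_right _ _ _).trans eη
  have c1 : IsCausal π → IsCausal (θ.map Prod.snd) := fun h =>
    isCausal_shadow h (by rw [eγ]; exact hγb.2) (by rw [eη]; exact hηb.1)
  have c2 : IsAnticausal π → IsAnticausal (θ.map Prod.snd) := fun h =>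
    isAnticausal_shadow h (by rw [eγ]; exact hγb.1) (by rw [eη]; exact hηb.2)
  have : IsProbabilityMeasure (θ.map Prod.snd) :=
    Measure.isProbabilityMeasure_map measurable_snd.aemeasurable
  refine ⟨θ, Measure.fst_compProd _ _, ⟨⟨?_, ?_⟩, ?_⟩, ?_, fun p => ?_⟩
  · rw [Measure.map_map measurable_fst measurable_snd, ← hγ2, ← eX,
      Measure.map_map measurable_snd (by fun_prop)]
    rfl
  · rw [Measure.map_map measurable_snd measurable_snd, ← hη2, ← eY,
      Measure.map_map measurable_snd (by fun_prop)]
    rfl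
  · cases b with
    | plain => trivial
    | causal => exact c1 hπb
    | anticausal => exact c2 hπb
    | bicausal => exact ⟨c1 hπb.1, c2 hπb.2⟩
  · have e : μ'.prod ν' = (γ.condKernel ∥ₖ η.condKernel) ∘ₘ (μ.prod ν) := by
      rw [comp_prod_parallelComp, ← Measure.snd_compProd, ← Measure.snd_compProd, eγ', eη',
        ← hγ2, ← hη2]
      rfl
    rw [KL_eq_klDiv, KL_eq_klDiv, e]
    have e' : θ.map Prod.snd = (γ.condKernel ∥ₖ η.condKernel) ∘ₘ π := Measure.snd_compProd _ _
    rw [e']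
    exact InformationTheory.klDiv_comp_right_le _ _ _
  · have mX : Measurable fun z : (∀ t, X t) × (∀ t, X t) => edist z.1 z.2 ^ p :=
      (measurable_edist).pow_const p
    have mY : Measurable fun z : (∀ t, Y t) × (∀ t, Y t) => edist z.1 z.2 ^ p :=
      (measurable_edist).pow_const p
    have m1 : Measurable fun ω : ((∀ t, X t) × (∀ t, Y t)) × ((∀ t, X t) × (∀ t, Y t)) =>
      (ω.1.1, ω.2.1) := by fun_prop
    have m2 : Measurable fun ω : ((∀ t, X t) × (∀ t, Y t)) × ((∀ t, X t) × (∀ t, Y t)) =>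
      (ω.1.2, ω.2.2) := by fun_prop
    rw [lcost, lcost, lcost2, ← eX, ← eY, lintegral_map mX m1, lintegral_map mY m2]
    exact lintegral_add_left (mX.comp m1) _

lemma map_swap_mem_aCouplings_bicausal {μ μ' : Measure (∀ t, X t)}
    {γ : Measure ((∀ t, X t) × (∀ t, X t))} (hγ : γ ∈ aCouplings .bicausal μ μ') :
    γ.map Prod.swap ∈ aCouplings .bicausal μ' μ := by
  obtain ⟨⟨h1, h2⟩, h3, h4⟩ := hγ
  refine ⟨⟨?_, ?_⟩, h4, ?_⟩
  · rw [Measure.map_map measurable_fst measurable_swap]; exact h2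
  · rw [Measure.map_map measurable_snd measurable_swap]; exact h1
  · rw [IsAnticausal, IsAnticausalFor, Measure.map_map measurable_swap measurable_swap]
    simpa [IsCausal] using h3

lemma lcost_map_swap {A : Type*} [MeasurableSpace A] [PseudoEMetricSpace A]
    [OpensMeasurableSpace A] [SecondCountableTopology A] (p : ℝ) (γ : Measure (A × A)) :
    lcost p (γ.map Prod.swap) = lcost p γ := by
  rw [lcost, lcost, lintegral_map (measurable_edist.pow_const p) measurable_swap]
  simp only [Prod.fst_swap, Prod.snd_swap, edist_comm]

end ShadowCoupling

section Convexity

variable {A B : Type*} [mA : MeasurableSpace A] [mB : MeasurableSpace B]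

lemma isCausalFor_iff_setIntegral {m : Fin N → MeasurableSpace A} {n : Fin N → MeasurableSpace B}
    (hm : ∀ t, m t ≤ mA) (hn : ∀ t, n t ≤ mB) {μ : Measure A} {π : Measure (A × B)}
    [IsProbabilityMeasure π] (hμ : π.map Prod.fst = μ) :
    IsCausalFor m n π ↔ ∀ t : Fin N, ∀ E C : Set A, ∀ F : Set B, MeasurableSet[m t] E →
      MeasurableSet[pastσOf m t] C → MeasurableSet[pastσOf n t] F →
      ∫ ω in C ×ˢ F, (μ[E.indicator (fun _ => (1 : ℝ)) | pastσOf m t]) ω.1 ∂π =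
        π.real ((E ∩ C) ×ˢ F) := by
  subst hμ
  have : IsProbabilityMeasure (π.map Prod.fst) :=
    Measure.isProbabilityMeasure_map measurable_fst.aemeasurable
  refine forall_congr' fun t => ?_
  have l1 := pastσOf_le hm t
  have l2 := pastσOf_le hn t
  have h1 : (m t).comap Prod.fst ≤ (inferInstance : MeasurableSpace (A × B)) :=
    (MeasurableSpace.comap_mono (hm t)).trans measurable_fst.comap_le
  have h2 : (pastσOf n t).comap Prod.snd ≤ (inferInstance : MeasurableSpace (A × B)) :=
    (MeasurableSpace.comap_mono l2).trans measurable_snd.comap_le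
  have h3 : (pastσOf m t).comap Prod.fst ≤ (inferInstance : MeasurableSpace (A × B)) :=
    (MeasurableSpace.comap_mono l1).trans measurable_fst.comap_le
  have e (E C : Set A) (F : Set B) : (E ∩ C) ×ˢ F =
      Prod.fst ⁻¹' E ∩ (Prod.snd ⁻¹' F ∩ Prod.fst ⁻¹' C) := by
    ext; simp only [mem_prod, mem_inter_iff, mem_preimage]; tauto
  have e' (C : Set A) (F : Set B) : C ×ˢ F = Prod.snd ⁻¹' F ∩ Prod.fst ⁻¹' C := by
    ext; simp only [mem_prod, mem_inter_iff, mem_preimage]; tauto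
  rw [condIndepσ_iff_doobIndep h1 h2 h3]
  constructor
  · intro h E C F hE hC hF
    have a := condExp_map_comp (P := π) measurable_fst l1
      (integrable_ind (P := π.map Prod.fst) (hm t _ hE))
    have hD : MeasurableSet[(pastσOf n t).comap Prod.snd ⊔ (pastσOf m t).comap Prod.fst]
        (C ×ˢ F) := by
      rw [e']
      exact (le_sup_left (a := (pastσOf n t).comap Prod.snd) _ ⟨F, hF, rfl⟩).inter
        (le_sup_right (a := (pastσOf n t).comap Prod.snd) _ ⟨C, hC, rfl⟩)
    have hE' : MeasurableSet (Prod.fst ⁻¹' E : Set (A × B)) := (hm t _ hE).preimage measurable_fst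
    have hD' := sup_le h2 h3 _ hD
    calc ∫ ω in C ×ˢ F, ((π.map Prod.fst)[E.indicator (fun _ => (1 : ℝ)) | pastσOf m t]) ω.1 ∂π
        = ∫ ω in C ×ˢ F, (π[(Prod.fst ⁻¹' E).indicator (fun _ => (1 : ℝ)) |
            (pastσOf n t).comap Prod.snd ⊔ (pastσOf m t).comap Prod.fst]) ω ∂π := by
          refine integral_congr_ae (ae_restrict_of_ae ?_)
          exact a.trans (h _ ⟨E, hE, rfl⟩).symm
      _ = ∫ ω in C ×ˢ F, (Prod.fst ⁻¹' E).indicator (fun _ => (1 : ℝ)) ω ∂π :=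
          setIntegral_condExp (sup_le h2 h3) (integrable_ind hE') hD
      _ = π.real ((E ∩ C) ×ˢ F) := by
          rw [setIntegral_indicator hE', setIntegral_const, smul_eq_mul, mul_one, e, e',
            inter_comm]
  · intro h
    refine doobIndep_of_setIntegral h1 h2 h3 ?_
    rintro _ ⟨E, hE, rfl⟩
    refine ⟨fun ω => ((π.map Prod.fst)[E.indicator (fun _ => (1 : ℝ)) | pastσOf m t]) ω.1,
      stronglyMeasurable_condExp.comp_measurable (comap_measurable Prod.fst),
      Integrable.comp_measurable integrable_condExp measurable_fst, ?_⟩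
    rintro _ _ ⟨F, hF, rfl⟩ ⟨C, hC, rfl⟩
    rw [← e, ← e']
    exact h E C F hE hC hF

lemma isProbabilityMeasure_half_add {Ω : Type*} [MeasurableSpace Ω] (π₁ π₂ : Measure Ω)
    [IsProbabilityMeasure π₁] [IsProbabilityMeasure π₂] :
    IsProbabilityMeasure ((2⁻¹ : ℝ≥0∞) • (π₁ + π₂)) := by
  constructor
  simp only [Measure.smul_apply, Measure.add_apply, measure_univ, smul_eq_mul, one_add_one_eq_two]
  exact ENNReal.inv_mul_cancel (by simp) (by simp)

lemma map_half_add {Ω Ω' : Type*} [MeasurableSpace Ω] [MeasurableSpace Ω'] {π₁ π₂ : Measure Ω}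
    {μ : Measure Ω'} {f : Ω → Ω'} (hf : Measurable f) (h₁ : π₁.map f = μ) (h₂ : π₂.map f = μ) :
    ((2⁻¹ : ℝ≥0∞) • (π₁ + π₂)).map f = μ := by
  rw [Measure.map_smul, Measure.map_add _ _ hf, h₁, h₂, ← two_smul ℝ≥0∞, smul_smul,
    ENNReal.inv_mul_cancel (by simp) (by simp), one_smul]

lemma IsCausalFor.half_add {m : Fin N → MeasurableSpace A} {n : Fin N → MeasurableSpace B}
    (hm : ∀ t, m t ≤ mA) (hn : ∀ t, n t ≤ mB) {μ : Measure A} {π₁ π₂ : Measure (A × B)}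
    [IsProbabilityMeasure π₁] [IsProbabilityMeasure π₂] (h₁ : π₁.map Prod.fst = μ)
    (h₂ : π₂.map Prod.fst = μ) (hc₁ : IsCausalFor m n π₁) (hc₂ : IsCausalFor m n π₂) :
    IsCausalFor m n ((2⁻¹ : ℝ≥0∞) • (π₁ + π₂)) := by
  have := isProbabilityMeasure_half_add π₁ π₂
  rw [isCausalFor_iff_setIntegral hm hn (map_half_add measurable_fst h₁ h₂)]
  rw [isCausalFor_iff_setIntegral hm hn h₁] at hc₁
  rw [isCausalFor_iff_setIntegral hm hn h₂] at hc₂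
  intro t E C F hE hC hF
  have i₁ : Integrable
      (fun ω => (μ[E.indicator (fun _ => (1 : ℝ)) | pastσOf m t]) (Prod.fst ω)) π₁ := by
    refine Integrable.comp_measurable ?_ measurable_fst
    rw [h₁]; exact integrable_condExp
  have i₂ : Integrable
      (fun ω => (μ[E.indicator (fun _ => (1 : ℝ)) | pastσOf m t]) (Prod.fst ω)) π₂ := by
    refine Integrable.comp_measurable ?_ measurable_fst
    rw [h₂]; exact integrable_condExp
  rw [Measure.restrict_smul, Measure.restrict_add, integral_smul_measure,
    integral_add_measure i₁.restrict i₂.restrict, hc₁ t E C F hE hC hF, hc₂ t E C F hE hC hF]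
  simp only [Measure.real, Measure.smul_apply, smul_eq_mul, ENNReal.toReal_mul,
    Measure.add_apply, ENNReal.toReal_add (measure_ne_top _ _) (measure_ne_top _ _)]

lemma IsCausalFor.prod {m : Fin N → MeasurableSpace A} {n : Fin N → MeasurableSpace B}
    (hm : ∀ t, m t ≤ mA) (hn : ∀ t, n t ≤ mB) (μ : Measure A) (ν : Measure B)
    [IsProbabilityMeasure μ] [IsProbabilityMeasure ν] : IsCausalFor m n (μ.prod ν) := by
  rw [isCausalFor_iff_setIntegral hm hn (μ := μ) Measure.fst_prod]
  intro t E C F hE hC hF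
  have h := setIntegral_prod_mul (μ := μ) (ν := ν)
    (μ[E.indicator (fun _ => (1 : ℝ)) | pastσOf m t]) (fun _ => (1 : ℝ)) C F
  simp only [mul_one] at h
  rw [h, setIntegral_condExp (pastσOf_le hm t) (integrable_ind (hm t _ hE)) hC,
    setIntegral_indicator (hm t _ hE), setIntegral_const, setIntegral_const, smul_eq_mul,
    smul_eq_mul, mul_one, mul_one, measureReal_prod_prod, inter_comm]

variable {X Y : Fin N → Type*} [∀ t, MeasurableSpace (X t)] [∀ t, MeasurableSpace (Y t)]
  {b : Flavor} {μ : Measure (∀ t, X t)} {ν : Measure (∀ t, Y t)}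

lemma half_add_mem_aCouplings [IsProbabilityMeasure μ]
    {π₁ π₂ : Measure ((∀ t, X t) × (∀ t, Y t))}
    (h₁ : π₁ ∈ aCouplings b μ ν) (h₂ : π₂ ∈ aCouplings b μ ν) :
    (2⁻¹ : ℝ≥0∞) • (π₁ + π₂) ∈ aCouplings b μ ν := by
  obtain ⟨⟨h₁f, h₁s⟩, h₁b⟩ := h₁
  obtain ⟨⟨h₂f, h₂s⟩, h₂b⟩ := h₂
  have := isProbabilityMeasure_of_map measurable_fst h₁f
  have := isProbabilityMeasure_of_map measurable_fst h₂f
  have : IsProbabilityMeasure (π₁.map Prod.swap) :=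
    Measure.isProbabilityMeasure_map measurable_swap.aemeasurable
  have : IsProbabilityMeasure (π₂.map Prod.swap) :=
    Measure.isProbabilityMeasure_map measurable_swap.aemeasurable
  have c1 : IsCausal π₁ → IsCausal π₂ → IsCausal ((2⁻¹ : ℝ≥0∞) • (π₁ + π₂)) :=
    IsCausalFor.half_add (coordσ_le X) (coordσ_le Y) h₁f h₂f
  have c2 : IsAnticausal π₁ → IsAnticausal π₂ → IsAnticausal ((2⁻¹ : ℝ≥0∞) • (π₁ + π₂)) := by
    intro g₁ g₂
    rw [IsAnticausal, IsAnticausalFor, Measure.map_smul, Measure.map_add _ _ measurable_swap]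
    refine IsCausalFor.half_add (μ := ν) (coordσ_le Y) (coordσ_le X) ?_ ?_ g₁ g₂
    · rw [Measure.map_map measurable_fst measurable_swap]; exact h₁s
    · rw [Measure.map_map measurable_fst measurable_swap]; exact h₂s
  refine ⟨⟨map_half_add measurable_fst h₁f h₂f, map_half_add measurable_snd h₁s h₂s⟩, ?_⟩
  cases b with
  | plain => trivial
  | causal => exact c1 h₁b h₂b
  | anticausal => exact c2 h₁b h₂b
  | bicausal => exact ⟨c1 h₁b.1 h₂b.1, c2 h₁b.2 h₂b.2⟩

variable (b μ ν) in
lemma prod_mem_aCouplings [IsProbabilityMeasure μ] [IsProbabilityMeasure ν] :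
    μ.prod ν ∈ aCouplings b μ ν := by
  have c1 : IsCausal (μ.prod ν) := IsCausalFor.prod (coordσ_le X) (coordσ_le Y) μ ν
  have c2 : IsAnticausal (μ.prod ν) := by
    rw [IsAnticausal, IsAnticausalFor, Measure.prod_swap]
    exact IsCausalFor.prod (coordσ_le Y) (coordσ_le X) ν μ
  refine ⟨⟨Measure.fst_prod, Measure.snd_prod⟩, ?_⟩
  cases b with
  | plain => trivial
  | causal => exact c1
  | anticausal => exact c2
  | bicausal => exact ⟨c1, c2⟩

end Convexity

section CostContinuity

lemma setLIntegral_le_tail_add {Ω : Type*} [MeasurableSpace Ω] {ρ : Measure Ω} {f : Ω → ℝ≥0∞}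
    (hf : Measurable f) (D : Set Ω) (R : ℝ≥0∞) :
    ∫⁻ ω in D, f ω ∂ρ ≤ ∫⁻ ω in {ω | R < f ω}, f ω ∂ρ + R * ρ D := by
  have hm : MeasurableSet {ω | R < f ω} := measurableSet_lt measurable_const hf
  calc ∫⁻ ω in D, f ω ∂ρ ≤ ∫⁻ ω in D, ({ω | R < f ω}.indicator f ω + R) ∂ρ := by
        refine lintegral_mono fun ω => ?_
        by_cases h : R < f ω
        · rw [indicator_of_mem (show ω ∈ {ω | R < f ω} from h)]
          exact le_self_add
        · exact (not_lt.1 h).trans le_add_self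
    _ = ∫⁻ ω in D, {ω | R < f ω}.indicator f ω ∂ρ + R * ρ D := by
        rw [lintegral_add_left (hf.indicator hm), setLIntegral_const]
    _ ≤ ∫⁻ ω, {ω | R < f ω}.indicator f ω ∂ρ + R * ρ D := by
        gcongr; exact Measure.restrict_le_self
    _ = _ := by rw [lintegral_indicator hm]

lemma exists_tail_le {Ω : Type*} [MeasurableSpace Ω] {ρ : Measure Ω} {f : Ω → ℝ≥0∞}
    (hf : Measurable f) (hfi : ∫⁻ ω, f ω ∂ρ ≠ ⊤) {δ : ℝ≥0∞} (hδ : δ ≠ 0) :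
    ∃ R : ℝ≥0, ∀ R' : ℝ≥0, R ≤ R' → ∫⁻ ω in {ω | (R' : ℝ≥0∞) < f ω}, f ω ∂ρ ≤ δ := by
  obtain ⟨η, hη, h⟩ := exists_pos_setLIntegral_lt_of_measure_lt hfi hδ
  obtain ⟨R, hR0, hR⟩ : ∃ R : ℝ≥0, 0 < R ∧ (∫⁻ ω, f ω ∂ρ) / R < η := by
    have ht : Tendsto (fun n : ℕ => (∫⁻ ω, f ω ∂ρ) / (n : ℝ≥0∞)) atTop (𝓝 0) := by
      simpa [div_eq_mul_inv] using
        ENNReal.Tendsto.const_mul ENNReal.tendsto_inv_nat_nhds_zero (Or.inr hfi)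
    obtain ⟨n, hn, hn'⟩ := ((ht.eventually (gt_mem_nhds hη)).and (eventually_gt_atTop 0)).exists
    exact ⟨n, by exact_mod_cast hn', by simpa using hn⟩
  refine ⟨R, fun R' hR' => (h _ ?_).le⟩
  have hR'0 : (R' : ℝ≥0∞) ≠ 0 := by exact_mod_cast (hR0.trans_le hR').ne'
  calc ρ {ω | (R' : ℝ≥0∞) < f ω} ≤ ρ {ω | (R' : ℝ≥0∞) ≤ f ω} :=
        measure_mono fun ω hω => (show (R' : ℝ≥0∞) < f ω from hω).le
    _ ≤ (∫⁻ ω, f ω ∂ρ) / R' := meas_ge_le_lintegral_div hf.aemeasurable hR'0 ENNReal.coe_ne_top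
    _ ≤ (∫⁻ ω, f ω ∂ρ) / R := by gcongr
    _ < η := hR

lemma exists_isCompact_compl_le {A : Type*} [TopologicalSpace A] [PolishSpace A]
    [MeasurableSpace A] [BorelSpace A] (μ : Measure A) [IsFiniteMeasure μ] {δ : ℝ≥0∞}
    (hδ : δ ≠ 0) : ∃ K : Set A, IsCompact K ∧ MeasurableSet K ∧ μ Kᶜ ≤ δ := by
  obtain ⟨K, hK, h⟩ := exists_isCompact_closure_measure_compl_lt μ δ (pos_iff_ne_zero.2 hδ)
  exact ⟨closure K, hK, isClosed_closure.measurableSet,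
    (measure_mono (compl_subset_compl.2 subset_closure)).trans h.le⟩

lemma one_le_two_rpow_sub_one {p : ℝ} (hp : 1 ≤ p) : (1 : ℝ≥0∞) ≤ 2 ^ (p - 1) := by
  simpa using ENNReal.rpow_le_rpow_of_exponent_le one_le_two (by linarith : (0 : ℝ) ≤ p - 1)

lemma edist_rpow_le {E : Type*} [PseudoEMetricSpace E] {p : ℝ} (hp : 1 ≤ p) (x y z : E) :
    edist x y ^ p ≤ 2 ^ (p - 1) * (edist x z ^ p + edist y z ^ p) := by
  refine le_trans ?_ (ENNReal.rpow_add_le_mul_rpow_add_rpow _ _ hp)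
  gcongr
  exact edist_triangle_right _ _ _

variable {A B : Type*} [MetricSpace A] [PolishSpace A] [MeasurableSpace A] [BorelSpace A]
  [MetricSpace B] [PolishSpace B] [MeasurableSpace B] [BorelSpace B]

/-- Comparison function for growth of order at most `p`. -/
def growthFn (p : ℝ) (x₀ : A) (y₀ : B) (z : A × B) : ℝ≥0∞ :=
  (1 + edist x₀ z.1 ^ p) + (1 + edist y₀ z.2 ^ p)

lemma measurable_one_add_edist_rpow (p : ℝ) (x₀ : A) :
    Measurable fun x : A => 1 + edist x₀ x ^ p :=
  measurable_const.add ((measurable_const.edist measurable_id).pow_const p)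

lemma measurable_growthFn (p : ℝ) (x₀ : A) (y₀ : B) : Measurable (growthFn p x₀ y₀) :=
  ((measurable_one_add_edist_rpow p x₀).comp measurable_fst).add
    ((measurable_one_add_edist_rpow p y₀).comp measurable_snd)

omit [PolishSpace A] [BorelSpace A] in
lemma MemPp.lintegral_one_add_ne_top {p : ℝ} {μ : Measure A} [IsProbabilityMeasure μ]
    (h : MemPp p μ) (x₀ : A) : ∫⁻ x, (1 + edist x₀ x ^ p) ∂μ ≠ ⊤ := by
  rw [lintegral_add_left measurable_const]
  simpa using h x₀

lemma lintegral_growthFn {p : ℝ} {μ : Measure A} {ν : Measure B} {π : Measure (A × B)}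
    (hπ : IsCoupling μ ν π) (x₀ : A) (y₀ : B) : ∫⁻ z, growthFn p x₀ y₀ z ∂π =
      ∫⁻ x, (1 + edist x₀ x ^ p) ∂μ + ∫⁻ y, (1 + edist y₀ y ^ p) ∂ν := by
  have h := lintegral_add_left (μ := π) ((measurable_one_add_edist_rpow p x₀).comp
    measurable_fst) (fun z => 1 + edist y₀ z.2 ^ p)
  rw [← hπ.1, ← hπ.2, lintegral_map (measurable_one_add_edist_rpow p x₀) measurable_fst,
    lintegral_map (measurable_one_add_edist_rpow p y₀) measurable_snd]
  exact h

/-- Tails of the growth function are small uniformly over the couplings of `μ` and `ν`. -/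
lemma exists_growthFn_tail {p : ℝ} {μ : Measure A} {ν : Measure B} [IsProbabilityMeasure μ]
    [IsProbabilityMeasure ν] (hμ : MemPp p μ) (hν : MemPp p ν) (x₀ : A) (y₀ : B) {δ : ℝ≥0∞}
    (hδ : δ ≠ 0) : ∃ R : ℝ≥0, ∀ (π : Measure (A × B)) (D : Set (A × B)), π.map Prod.fst ≤ μ →
      π.map Prod.snd ≤ ν → ∫⁻ z in D, growthFn p x₀ y₀ z ∂π ≤ δ + R * π D := by
  obtain ⟨R₁, h₁⟩ := exists_tail_le (measurable_one_add_edist_rpow p x₀)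
    (hμ.lintegral_one_add_ne_top x₀) (ENNReal.half_pos hδ).ne'
  obtain ⟨R₂, h₂⟩ := exists_tail_le (measurable_one_add_edist_rpow p y₀)
    (hν.lintegral_one_add_ne_top y₀) (ENNReal.half_pos hδ).ne'
  refine ⟨R₁ + R₂, fun π D hπ1 hπ2 => ?_⟩
  have m₁ := measurable_one_add_edist_rpow p x₀
  have m₂ := measurable_one_add_edist_rpow p y₀
  have e₁ := setLIntegral_le_tail_add (ρ := π) (m₁.comp measurable_fst) D R₁
  have e₂ := setLIntegral_le_tail_add (ρ := π) (m₂.comp measurable_snd) D R₂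
  have f₁ : ∫⁻ ω in {ω : A × B | (R₁ : ℝ≥0∞) < 1 + edist x₀ ω.1 ^ p}, (1 + edist x₀ ω.1 ^ p) ∂π ≤
      δ / 2 := by
    refine le_trans (le_of_eq ?_) ((lintegral_mono' (Measure.restrict_mono_measure hπ1 _)
      le_rfl).trans (h₁ R₁ le_rfl))
    rw [setLIntegral_map (measurableSet_lt measurable_const m₁) m₁ measurable_fst]
    rfl
  have f₂ : ∫⁻ ω in {ω : A × B | (R₂ : ℝ≥0∞) < 1 + edist y₀ ω.2 ^ p}, (1 + edist y₀ ω.2 ^ p) ∂π ≤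
      δ / 2 := by
    refine le_trans (le_of_eq ?_) ((lintegral_mono' (Measure.restrict_mono_measure hπ2 _)
      le_rfl).trans (h₂ R₂ le_rfl))
    rw [setLIntegral_map (measurableSet_lt measurable_const m₂) m₂ measurable_snd]
    rfl
  calc ∫⁻ z in D, growthFn p x₀ y₀ z ∂π
      = ∫⁻ z in D, (1 + edist x₀ z.1 ^ p) ∂π + ∫⁻ z in D, (1 + edist y₀ z.2 ^ p) ∂π :=
        lintegral_add_left (m₁.comp measurable_fst) _
    _ ≤ (δ / 2 + R₁ * π D) + (δ / 2 + R₂ * π D) :=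
        add_le_add (e₁.trans (by gcongr; exact f₁)) (e₂.trans (by gcongr; exact f₂))
    _ = δ + ((R₁ + R₂ : ℝ≥0) : ℝ≥0∞) * π D := by
        rw [add_add_add_comm, ENNReal.add_halves, ENNReal.coe_add, add_mul]

omit [PolishSpace A] [MeasurableSpace A] [BorelSpace A] [PolishSpace B] [MeasurableSpace B]
  [BorelSpace B] in
lemma GrowthLE.enorm_le {p : ℝ} (hp : 0 ≤ p) {c : A × B → ℝ} (hc : GrowthLE p c) :
    ∃ (x₀ : A) (y₀ : B) (M : ℝ≥0), ∀ z, ‖c z‖ₑ ≤ M * growthFn p x₀ y₀ z := by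
  obtain ⟨x₀, y₀, M, h⟩ := hc
  refine ⟨x₀, y₀, M.toNNReal, fun z => ?_⟩
  have e1 : ENNReal.ofReal ((edist x₀ z.1).toReal ^ p) = edist x₀ z.1 ^ p := by
    rw [← ENNReal.ofReal_rpow_of_nonneg ENNReal.toReal_nonneg hp,
      ENNReal.ofReal_toReal (edist_ne_top _ _)]
  have e2 : ENNReal.ofReal ((edist y₀ z.2).toReal ^ p) = edist y₀ z.2 ^ p := by
    rw [← ENNReal.ofReal_rpow_of_nonneg ENNReal.toReal_nonneg hp,
      ENNReal.ofReal_toReal (edist_ne_top _ _)]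
  have n1 : 0 ≤ (edist x₀ z.1).toReal ^ p := by positivity
  have n2 : 0 ≤ (edist y₀ z.2).toReal ^ p := by positivity
  rw [Real.enorm_eq_ofReal_abs]
  refine (ENNReal.ofReal_le_ofReal (h z)).trans ?_
  rw [ENNReal.ofReal_mul' (by positivity), ENNReal.ofReal_add (by positivity) n2,
    ENNReal.ofReal_add zero_le_one n1, e1, e2, ENNReal.ofReal_one, growthFn]
  change (M.toNNReal : ℝ≥0∞) * _ ≤ _
  gcongr
  exact le_add_self

/-- A continuous function of growth of order at most `p` is integrable under couplings of measures
with finite `p`-th moments. -/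
lemma GrowthLE.integrable {p : ℝ} (hp : 0 ≤ p) {c : A × B → ℝ} (hc : GrowthLE p c)
    (hcc : Continuous c) {μ : Measure A} {ν : Measure B} [IsProbabilityMeasure μ]
    [IsProbabilityMeasure ν] (hμ : MemPp p μ) (hν : MemPp p ν) {π : Measure (A × B)}
    (hπ : IsCoupling μ ν π) : Integrable c π := by
  obtain ⟨x₀, y₀, M, h⟩ := hc.enorm_le hp
  refine ⟨hcc.measurable.aestronglyMeasurable, ?_⟩
  calc ∫⁻ z, ‖c z‖ₑ ∂π ≤ ∫⁻ z, M * growthFn p x₀ y₀ z ∂π := lintegral_mono h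
    _ = M * ∫⁻ z, growthFn p x₀ y₀ z ∂π :=
        lintegral_const_mul _ (measurable_growthFn p x₀ y₀)
    _ < ⊤ := by
        rw [lintegral_growthFn hπ]
        exact ENNReal.mul_lt_top ENNReal.coe_lt_top (ENNReal.add_lt_top.2
          ⟨(hμ.lintegral_one_add_ne_top x₀).lt_top, (hν.lintegral_one_add_ne_top y₀).lt_top⟩)

omit [PolishSpace A] [MeasurableSpace A] [BorelSpace A] [PolishSpace B] [MeasurableSpace B]
  [BorelSpace B] in
lemma growthFn_ne_top {p : ℝ} (hp : 0 ≤ p) (x₀ : A) (y₀ : B) (z : A × B) :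
    growthFn p x₀ y₀ z ≠ ⊤ := by
  simp [growthFn, ENNReal.rpow_eq_top_iff, edist_ne_top, hp.not_gt]

omit [PolishSpace A] [MeasurableSpace A] [BorelSpace A] [PolishSpace B] [MeasurableSpace B]
  [BorelSpace B] in
lemma continuous_growthFn (p : ℝ) (x₀ : A) (y₀ : B) : Continuous (growthFn p x₀ y₀) := by
  have h1 : Continuous fun z : A × B => edist x₀ z.1 ^ p :=
    ENNReal.continuous_rpow_const.comp (continuous_const.edist continuous_fst)
  have h2 : Continuous fun z : A × B => edist y₀ z.2 ^ p :=
    ENNReal.continuous_rpow_const.comp (continuous_const.edist continuous_snd)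
  exact (continuous_const.add h1).add (continuous_const.add h2)

omit [PolishSpace A] [MeasurableSpace A] [BorelSpace A] [PolishSpace B] [MeasurableSpace B]
  [BorelSpace B] in
lemma growthFn_le {p : ℝ} (hp : 1 ≤ p) (x₀ : A) (y₀ : B) (z z' : A × B) :
    growthFn p x₀ y₀ z ≤ 2 ^ (p - 1) * (growthFn p x₀ y₀ z' +
      (edist z.1 z'.1 ^ p + edist z.2 z'.2 ^ p)) := by
  have h2 := one_le_two_rpow_sub_one hp
  calc growthFn p x₀ y₀ z
      ≤ (2 ^ (p - 1) * 1 + 2 ^ (p - 1) * (edist x₀ z'.1 ^ p + edist z.1 z'.1 ^ p)) +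
        (2 ^ (p - 1) * 1 + 2 ^ (p - 1) * (edist y₀ z'.2 ^ p + edist z.2 z'.2 ^ p)) := by
        rw [growthFn]
        gcongr
        · rwa [mul_one]
        · exact edist_rpow_le hp _ _ _
        · rwa [mul_one]
        · exact edist_rpow_le hp _ _ _
    _ = _ := by rw [growthFn]; ring

/-- Integrals of a continuous function of growth of order at most `p` against `θ.map Prod.fst` and
`θ.map Prod.snd` are close when the transport cost of `θ` is small. -/
lemma GrowthLE.exists_lintegral_enorm_sub_le {p : ℝ} (hp : 1 ≤ p) {c : A × B → ℝ}
    (hc : GrowthLE p c) (hcc : Continuous c) {μ : Measure A} {ν : Measure B}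
    [IsProbabilityMeasure μ] [IsProbabilityMeasure ν] (hμ : MemPp p μ) (hν : MemPp p ν)
    {δ : ℝ≥0∞} (hδ : δ ≠ 0) : ∃ η : ℝ≥0∞, η ≠ 0 ∧ ∀ θ : Measure ((A × B) × (A × B)),
      IsProbabilityMeasure θ → IsCoupling μ ν (θ.map Prod.snd) → lcost2 p θ ≤ η →
      ∫⁻ z, ‖c z.1 - c z.2‖ₑ ∂θ ≤ δ := by
  obtain ⟨x₀, y₀, M, hM⟩ := hc.enorm_le (zero_le_one.trans hp)
  have hp0 : 0 < p := zero_lt_one.trans_le hp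
  obtain ⟨C, hC1, hC⟩ : ∃ C : ℝ≥0, 0 < C ∧ ∀ z z' : A × B, ‖c z - c z'‖ₑ ≤
      C * (growthFn p x₀ y₀ z' + (edist z.1 z'.1 ^ p + edist z.2 z'.2 ^ p)) := by
    have hfin : (2 : ℝ≥0∞) ^ (p - 1) ≠ ⊤ :=
      ENNReal.rpow_ne_top_of_nonneg (by linarith) ENNReal.ofNat_ne_top
    refine ⟨M * ((2 : ℝ≥0∞) ^ (p - 1)).toNNReal + M + 1, by positivity, fun z z' => ?_⟩
    rw [ENNReal.coe_add, ENNReal.coe_add, ENNReal.coe_mul, ENNReal.coe_toNNReal hfin]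
    calc ‖c z - c z'‖ₑ ≤ ‖c z‖ₑ + ‖c z'‖ₑ := enorm_sub_le
      _ ≤ M * growthFn p x₀ y₀ z + M * growthFn p x₀ y₀ z' := add_le_add (hM z) (hM z')
      _ ≤ M * (2 ^ (p - 1) * (growthFn p x₀ y₀ z' + (edist z.1 z'.1 ^ p + edist z.2 z'.2 ^ p))) +
          M * (growthFn p x₀ y₀ z' + (edist z.1 z'.1 ^ p + edist z.2 z'.2 ^ p)) := by
          gcongr
          · exact growthFn_le hp _ _ _ _
          · exact le_self_add
      _ ≤ _ := by
          rw [← mul_assoc, ← add_mul]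
          gcongr ?_ * _
          exact le_self_add
  have hC0 : (C : ℝ≥0∞) ≠ 0 := by exact_mod_cast hC1.ne'
  have hδ3 : δ / 3 ≠ 0 := (ENNReal.div_pos hδ ENNReal.ofNat_ne_top).ne'
  set t : ℝ≥0∞ := δ / 3 / (2 * C) with ht
  have htC : C * (t + t) = δ / 3 := by
    rw [← two_mul, ← mul_assoc, mul_comm (C : ℝ≥0∞), ht,
      ENNReal.mul_div_cancel (mul_ne_zero two_ne_zero hC0)
        (ENNReal.mul_ne_top ENNReal.ofNat_ne_top ENNReal.coe_ne_top)]
  have ht0 : t ≠ 0 := (ENNReal.div_pos hδ3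
    (ENNReal.mul_ne_top ENNReal.ofNat_ne_top ENNReal.coe_ne_top)).ne'
  obtain ⟨R, hR⟩ := exists_growthFn_tail hμ hν x₀ y₀ ht0
  have hκ : t / (R + 1) / 2 ≠ 0 := (ENNReal.half_pos (ENNReal.div_pos ht0 (by simp)).ne').ne'
  obtain ⟨K₁, hK₁, mK₁, hμK⟩ := exists_isCompact_compl_le μ hκ
  obtain ⟨K₂, hK₂, mK₂, hνK⟩ := exists_isCompact_compl_le ν hκ
  have hK : IsCompact (K₁ ×ˢ K₂) := hK₁.prod hK₂
  have mK : MeasurableSet (K₁ ×ˢ K₂) := mK₁.prod mK₂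
  obtain ⟨S, hS⟩ : ∃ S : ℝ≥0, ∀ z ∈ K₁ ×ˢ K₂, growthFn p x₀ y₀ z ≤ S := by
    rcases (K₁ ×ˢ K₂).eq_empty_or_nonempty with h | h
    · exact ⟨0, by simp [h]⟩
    · obtain ⟨z₁, -, h₁⟩ := hK.exists_isMaxOn h (continuous_growthFn p x₀ y₀).continuousOn
      refine ⟨(growthFn p x₀ y₀ z₁).toNNReal, fun z hz => ?_⟩
      rw [ENNReal.coe_toNNReal (growthFn_ne_top hp0.le _ _ _)]
      exact h₁ hz
  obtain ⟨r, hr0, hr⟩ : ∃ r : ℝ≥0, 0 < r ∧ ∀ z z' : A × B, z' ∈ K₁ ×ˢ K₂ → edist z.1 z'.1 < r →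
      edist z.2 z'.2 < r → ‖c z - c z'‖ₑ ≤ δ / 3 := by
    have h := hK.uniformContinuousAt_of_continuousAt c (fun z _ => hcc.continuousAt)
      (edist_mem_uniformity (pos_iff_ne_zero.2 hδ3))
    obtain ⟨r, hr0, hr⟩ := mem_uniformity_edist.1 h
    obtain ⟨r', hr', hrr⟩ := ENNReal.lt_iff_exists_nnreal_btwn.1 hr0
    refine ⟨r', by exact_mod_cast hr', fun z z' hz' h1 h2 => ?_⟩
    have := hr (a := z') (b := z) (by
      rw [edist_comm, Prod.edist_eq]
      exact (max_lt h1 h2).trans hrr) hz'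
    rw [← edist_eq_enorm_sub, edist_comm]
    exact le_of_lt this
  have hrp : (r : ℝ≥0∞) ^ p ≠ 0 := by simp [ENNReal.rpow_eq_zero_iff, hr0.ne', hp0.not_gt]
  have hrp' : (r : ℝ≥0∞) ^ p ≠ ⊤ := ENNReal.rpow_ne_top_of_nonneg hp0.le ENNReal.coe_ne_top
  set L : ℝ≥0∞ := C * (S / r ^ p + 1) with hL
  have hL0 : L ≠ 0 := mul_ne_zero hC0 (by simp)
  have hLt : L ≠ ⊤ := ENNReal.mul_ne_top ENNReal.coe_ne_top
    (ENNReal.add_ne_top.2 ⟨ENNReal.div_ne_top ENNReal.coe_ne_top hrp, ENNReal.one_ne_top⟩)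
  have key (z z' : A × B) : ‖c z - c z'‖ₑ ≤
      (δ / 3 + C * (K₁ ×ˢ K₂)ᶜ.indicator (growthFn p x₀ y₀) z') +
        L * (edist z.1 z'.1 ^ p + edist z.2 z'.2 ^ p) := by
    by_cases hz : z' ∈ K₁ ×ˢ K₂
    · by_cases hd : edist z.1 z'.1 < r ∧ edist z.2 z'.2 < r
      · exact (hr z z' hz hd.1 hd.2).trans (le_self_add.trans le_self_add)
      · have hu : (r : ℝ≥0∞) ^ p ≤ edist z.1 z'.1 ^ p + edist z.2 z'.2 ^ p := by
          rcases not_and_or.1 hd with h | h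
          · exact (ENNReal.rpow_le_rpow (not_lt.1 h) hp0.le).trans le_self_add
          · exact (ENNReal.rpow_le_rpow (not_lt.1 h) hp0.le).trans le_add_self
        refine (hC z z').trans (le_trans ?_ le_add_self)
        rw [hL, mul_assoc, add_mul, one_mul]
        gcongr
        calc growthFn p x₀ y₀ z' ≤ S := hS z' hz
          _ = S / r ^ p * r ^ p := (ENNReal.div_mul_cancel hrp hrp').symm
          _ ≤ _ := by gcongr
    · rw [indicator_of_mem (show z' ∈ (K₁ ×ˢ K₂)ᶜ from hz)]
      refine (hC z z').trans ?_
      rw [mul_add]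
      gcongr
      · exact le_add_self
      · rw [hL, mul_add, mul_one]
        exact le_add_self
  refine ⟨δ / 3 / L, (ENNReal.div_pos hδ3 hLt).ne', fun θ hθ hcoup hcost => ?_⟩
  have mI : Measurable fun z : (A × B) × (A × B) =>
      (K₁ ×ˢ K₂)ᶜ.indicator (growthFn p x₀ y₀) z.2 :=
    ((measurable_growthFn p x₀ y₀).indicator mK.compl).comp measurable_snd
  have hmass : θ.map Prod.snd (K₁ ×ˢ K₂)ᶜ ≤ t / (R + 1) := by
    rw [compl_prod_eq_union]
    refine (measure_union_le _ _).trans ?_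
    rw [← ENNReal.add_halves (t / (R + 1))]
    refine add_le_add ?_ ?_
    · rw [prod_univ, ← Measure.map_apply measurable_fst mK₁.compl, hcoup.1]
      exact hμK
    · rw [univ_prod, ← Measure.map_apply measurable_snd mK₂.compl, hcoup.2]
      exact hνK
  have htail : ∫⁻ z, (K₁ ×ˢ K₂)ᶜ.indicator (growthFn p x₀ y₀) z.2 ∂θ ≤ t + t := by
    rw [← lintegral_map ((measurable_growthFn p x₀ y₀).indicator mK.compl) measurable_snd,
      lintegral_indicator mK.compl]
    refine (hR _ _ hcoup.1.le hcoup.2.le).trans ?_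
    gcongr
    calc R * θ.map Prod.snd (K₁ ×ˢ K₂)ᶜ ≤ (R + 1) * (t / (R + 1)) := by
          gcongr
          exact le_self_add
      _ = t := ENNReal.mul_div_cancel (by simp) (by simp)
  calc ∫⁻ z, ‖c z.1 - c z.2‖ₑ ∂θ ≤ ∫⁻ z,
        ((δ / 3 + C * (K₁ ×ˢ K₂)ᶜ.indicator (growthFn p x₀ y₀) z.2) +
          L * (edist z.1.1 z.2.1 ^ p + edist z.1.2 z.2.2 ^ p)) ∂θ :=
        lintegral_mono fun z => key z.1 z.2
    _ = δ / 3 + C * ∫⁻ z, (K₁ ×ˢ K₂)ᶜ.indicator (growthFn p x₀ y₀) z.2 ∂θ + L * lcost2 p θ := by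
        rw [lintegral_add_left (f := fun z : (A × B) × (A × B) => δ / 3 + C * 
          (K₁ ×ˢ K₂)ᶜ.indicator (growthFn p x₀ y₀) z.2) (measurable_const.add (mI.const_mul _)),
          lintegral_add_left measurable_const, lintegral_const, measure_univ, mul_one,
          lintegral_const_mul _ mI, lintegral_const_mul' _ _ hLt, lcost2]
    _ ≤ δ / 3 + δ / 3 + δ / 3 := by
        gcongr
        · exact (by gcongr : _ ≤ C * (t + t)).trans_eq htC
        · calc L * lcost2 p θ ≤ L * (δ / 3 / L) := by gcongr
            _ = δ / 3 := ENNReal.mul_div_cancel hL0 hLt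
    _ = δ := ENNReal.add_thirds δ

lemma GrowthLE.exists_abs_integral_sub_le {p : ℝ} (hp : 1 ≤ p) {c : A × B → ℝ}
    (hc : GrowthLE p c) (hcc : Continuous c) {μ : Measure A} {ν : Measure B}
    [IsProbabilityMeasure μ] [IsProbabilityMeasure ν] (hμ : MemPp p μ) (hν : MemPp p ν)
    {δ : ℝ} (hδ : 0 < δ) : ∃ η : ℝ≥0∞, η ≠ 0 ∧ ∀ (μ' : Measure A) (ν' : Measure B)
      (θ : Measure ((A × B) × (A × B))), IsProbabilityMeasure μ' → IsProbabilityMeasure ν' →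
      MemPp p μ' → MemPp p ν' → IsProbabilityMeasure θ → IsCoupling μ' ν' (θ.map Prod.fst) →
      IsCoupling μ ν (θ.map Prod.snd) → lcost2 p θ ≤ η →
      |∫ z, c z ∂(θ.map Prod.fst) - ∫ z, c z ∂(θ.map Prod.snd)| ≤ δ := by
  obtain ⟨η, hη, h⟩ := hc.exists_lintegral_enorm_sub_le hp hcc hμ hν
    (ENNReal.ofReal_pos.2 hδ).ne'
  refine ⟨η, hη, fun μ' ν' θ _ _ hμ' hν' hθ h1 h2 hcost => ?_⟩
  have hp0 : 0 ≤ p := zero_le_one.trans hp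
  have i1 := (hc.integrable hp0 hcc hμ' hν' h1).comp_measurable measurable_fst
  have i2 := (hc.integrable hp0 hcc hμ hν h2).comp_measurable measurable_snd
  rw [integral_map measurable_fst.aemeasurable hcc.measurable.aestronglyMeasurable,
    integral_map measurable_snd.aemeasurable hcc.measurable.aestronglyMeasurable]
  change |∫ z, (c ∘ Prod.fst) z ∂θ - ∫ z, (c ∘ Prod.snd) z ∂θ| ≤ δ
  rw [← integral_sub i1 i2, ← Real.norm_eq_abs, ← ENNReal.ofReal_le_ofReal_iff hδ.le,
    ofReal_norm]
  exact (enorm_integral_le_lintegral_enorm _).trans (h θ hθ h2 hcost)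

end CostContinuity

section StrictConvexity

open InformationTheory

lemma mul_log_ge_add_sqrt {a s : ℝ} (ha : 0 ≤ a) (hs : 0 < s) :
    a * Real.log s + 2 * (a - √a * √s) ≤ a * Real.log a := by
  rcases ha.eq_or_lt with rfl | ha
  · simp
  have h := Real.log_le_sub_one_of_pos (div_pos (Real.sqrt_pos.2 hs) (Real.sqrt_pos.2 ha))
  rw [Real.log_div (Real.sqrt_pos.2 hs).ne' (Real.sqrt_pos.2 ha).ne', Real.log_sqrt hs.le,
    Real.log_sqrt ha.le] at h
  have h' := mul_le_mul_of_nonneg_left h ha.le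
  have e : a * (√s / √a) = √a * √s := by
    rw [mul_div_assoc', div_eq_iff (Real.sqrt_pos.2 ha).ne']
    rw [mul_right_comm, Real.mul_self_sqrt ha.le]
  rw [mul_sub, mul_sub, e] at h'
  linarith

/-- Quantitative strict convexity of `klFun`. -/
lemma sq_sqrt_sub_sqrt_le_klFun_gap {a b : ℝ} (ha : 0 ≤ a) (hb : 0 ≤ b) :
    (√a - √b) ^ 2 / 4 ≤ klFun a / 2 + klFun b / 2 - klFun ((a + b) / 2) := by
  rcases (add_nonneg ha hb).eq_or_lt with h | h
  · obtain rfl : a = 0 := by linarith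
    obtain rfl : b = 0 := by linarith
    simp
  have hs : 0 < (a + b) / 2 := by linarith
  have h1 := mul_log_ge_add_sqrt ha hs
  have h2 := mul_log_ge_add_sqrt hb hs
  have e1 := Real.mul_self_sqrt ha
  have e2 := Real.mul_self_sqrt hb
  have e3 := Real.mul_self_sqrt hs.le
  simp only [klFun]
  nlinarith [sq_nonneg (√((a + b) / 2) - (√a + √b) / 2)]

lemma abs_sub_le_klFun_gap {a b δ : ℝ} (ha : 0 ≤ a) (hb : 0 ≤ b) (hδ : 0 < δ) :
    |a - b| ≤ 2 / δ * (klFun a / 2 + klFun b / 2 - klFun ((a + b) / 2)) + δ * (a + b) := by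
  have h := mul_le_mul_of_nonneg_left (sq_sqrt_sub_sqrt_le_klFun_gap ha hb)
    (by positivity : 0 ≤ 2 / δ)
  refine le_trans ?_ (add_le_add_left h _)
  have e1 := Real.mul_self_sqrt ha
  have e2 := Real.mul_self_sqrt hb
  have e : a - b = (√a - √b) * (√a + √b) := by linarith [mul_self_sub_mul_self √a √b]
  rw [e, abs_mul, abs_of_nonneg (by positivity : 0 ≤ √a + √b)]
  have h3 : (√a + √b) ^ 2 ≤ 2 * (a + b) := by nlinarith [sq_nonneg (√a - √b)]
  have h4 : δ * (|√a - √b| * (√a + √b)) ≤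
      δ * (2 / δ * ((√a - √b) ^ 2 / 4) + δ * (a + b)) := by
    have : δ * (2 / δ * ((√a - √b) ^ 2 / 4) + δ * (a + b)) =
        (√a - √b) ^ 2 / 2 + δ ^ 2 * (a + b) := by field_simp; ring
    rw [this, ← sq_abs (√a - √b)]
    nlinarith [sq_nonneg (|√a - √b| - δ * (√a + √b)), mul_le_mul_of_nonneg_left h3 (sq_nonneg δ)]
  exact le_of_mul_le_mul_left h4 hδ

variable {Ω : Type*} [MeasurableSpace Ω]

lemma rnDeriv_half_add (π₁ π₂ P : Measure Ω) [IsProbabilityMeasure π₁] [IsProbabilityMeasure π₂]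
    [IsProbabilityMeasure P] : ∀ᵐ ω ∂P, (((2⁻¹ : ℝ≥0∞) • (π₁ + π₂)).rnDeriv P ω).toReal =
      ((π₁.rnDeriv P ω).toReal + (π₂.rnDeriv P ω).toReal) / 2 := by
  filter_upwards [Measure.rnDeriv_smul_left_of_ne_top (π₁ + π₂) P (r := 2⁻¹) (by simp),
    Measure.rnDeriv_add π₁ π₂ P, π₁.rnDeriv_lt_top P, π₂.rnDeriv_lt_top P] with ω h1 h2 h3 h4
  rw [h1, Pi.smul_apply, h2, Pi.add_apply, smul_eq_mul, ENNReal.toReal_mul,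
    ENNReal.toReal_add h3.ne h4.ne]
  simp
  ring

/-- The total variation distance is controlled by the gap in the midpoint convexity inequality
for the relative entropy. -/
lemma integral_abs_rnDeriv_sub_le {π₁ π₂ P : Measure Ω} [IsProbabilityMeasure π₁]
    [IsProbabilityMeasure π₂] [IsProbabilityMeasure P] (h₁ : klDiv π₁ P ≠ ⊤)
    (h₂ : klDiv π₂ P ≠ ⊤) : klDiv ((2⁻¹ : ℝ≥0∞) • (π₁ + π₂)) P ≠ ⊤ ∧ ∀ δ : ℝ, 0 < δ →
    ∫ ω, |(π₁.rnDeriv P ω).toReal - (π₂.rnDeriv P ω).toReal| ∂P ≤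
      2 / δ * ((klDiv π₁ P).toReal / 2 + (klDiv π₂ P).toReal / 2 -
        (klDiv ((2⁻¹ : ℝ≥0∞) • (π₁ + π₂)) P).toReal) + 2 * δ := by
  have := isProbabilityMeasure_half_add π₁ π₂
  obtain ⟨ac₁, i₁⟩ := klDiv_ne_top_iff.1 h₁
  obtain ⟨ac₂, i₂⟩ := klDiv_ne_top_iff.1 h₂
  have ac : (2⁻¹ : ℝ≥0∞) • (π₁ + π₂) ≪ P := (ac₁.add_left ac₂).smul_left _
  have k₁ := (integrable_klFun_rnDeriv_iff ac₁).2 i₁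
  have k₂ := (integrable_klFun_rnDeriv_iff ac₂).2 i₂
  have hm := rnDeriv_half_add π₁ π₂ P
  have gap (ω : Ω) := sq_sqrt_sub_sqrt_le_klFun_gap (ENNReal.toReal_nonneg (a := π₁.rnDeriv P ω))
    (ENNReal.toReal_nonneg (a := π₂.rnDeriv P ω))
  have k : Integrable (fun ω => klFun (((2⁻¹ : ℝ≥0∞) • (π₁ + π₂)).rnDeriv P ω).toReal) P := by
    refine ((k₁.div_const 2).add (k₂.div_const 2)).mono'
      (measurable_klFun.comp
        (Measure.measurable_rnDeriv _ _).ennreal_toReal).aestronglyMeasurable ?_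
    filter_upwards [hm] with ω hω
    rw [Real.norm_of_nonneg (klFun_nonneg ENNReal.toReal_nonneg), hω]
    have := gap ω
    simp only [Pi.add_apply]
    nlinarith [sq_nonneg (√(π₁.rnDeriv P ω).toReal - √(π₂.rnDeriv P ω).toReal)]
  refine ⟨klDiv_ne_top ac ((integrable_klFun_rnDeriv_iff ac).1 k), fun δ hδ => ?_⟩
  have f₁ := Measure.integrable_toReal_rnDeriv (μ := π₁) (ν := P)
  have f₂ := Measure.integrable_toReal_rnDeriv (μ := π₂) (ν := P)
  rw [toReal_klDiv_eq_integral_klFun ac₁, toReal_klDiv_eq_integral_klFun ac₂,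
    toReal_klDiv_eq_integral_klFun ac]
  have e₁ : ∫ ω, (π₁.rnDeriv P ω).toReal ∂P = 1 := by
    rw [Measure.integral_toReal_rnDeriv ac₁]; simp
  have e₂ : ∫ ω, (π₂.rnDeriv P ω).toReal ∂P = 1 := by
    rw [Measure.integral_toReal_rnDeriv ac₂]; simp
  have f₁₂ : Integrable (fun ω => (π₁.rnDeriv P ω).toReal + (π₂.rnDeriv P ω).toReal) P := f₁.add f₂
  have k₁₂ : Integrable (fun ω => klFun (π₁.rnDeriv P ω).toReal / 2 +
      klFun (π₂.rnDeriv P ω).toReal / 2) P := (k₁.div_const 2).add (k₂.div_const 2)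
  have g : Integrable (fun ω => klFun (π₁.rnDeriv P ω).toReal / 2 +
      klFun (π₂.rnDeriv P ω).toReal / 2 -
      klFun (((2⁻¹ : ℝ≥0∞) • (π₁ + π₂)).rnDeriv P ω).toReal) P := k₁₂.sub k
  have h := integral_mono_ae (f₁.sub f₂).abs ((g.const_mul (2 / δ)).add (f₁₂.const_mul δ))
    (by
      filter_upwards [hm] with ω hω
      simp only [Pi.add_apply, Pi.sub_apply, hω]
      exact abs_sub_le_klFun_gap ENNReal.toReal_nonneg ENNReal.toReal_nonneg hδ)
  refine h.trans (le_of_eq ?_)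
  simp only [Pi.add_apply]
  rw [integral_add (g.const_mul (2 / δ)) (f₁₂.const_mul δ), integral_const_mul,
    integral_const_mul, integral_sub k₁₂ k,
    integral_add f₁ f₂, integral_add (k₁.div_const 2) (k₂.div_const 2), integral_div,
    integral_div, e₁, e₂]
  ring

end StrictConvexity

section TotalVariationCoupling

variable {Ω : Type*} [MeasurableSpace Ω]

lemma exists_add_eq_add_eq {π₁ π₂ P : Measure Ω} [IsProbabilityMeasure π₁]
    [IsProbabilityMeasure π₂] [IsProbabilityMeasure P] (h₁ : π₁ ≪ P) (h₂ : π₂ ≪ P) :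
    ∃ κ σ₁ σ₂ : Measure Ω, κ + σ₁ = π₁ ∧ κ + σ₂ = π₂ ∧ σ₁ univ ≤
      ENNReal.ofReal (∫ ω, |(π₁.rnDeriv P ω).toReal - (π₂.rnDeriv P ω).toReal| ∂P) := by
  have m₁ := Measure.measurable_rnDeriv π₁ P
  have m₂ := Measure.measurable_rnDeriv π₂ P
  refine ⟨P.withDensity fun ω => min (π₁.rnDeriv P ω) (π₂.rnDeriv P ω),
    P.withDensity fun ω => π₁.rnDeriv P ω - π₂.rnDeriv P ω,
    P.withDensity fun ω => π₂.rnDeriv P ω - π₁.rnDeriv P ω, ?_, ?_, ?_⟩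
  · rw [← withDensity_add_left (m₁.min m₂)]
    conv_rhs => rw [← Measure.withDensity_rnDeriv_eq π₁ P h₁]
    congr 1
    ext ω
    simp only [Pi.add_apply]
    rcases le_total (π₁.rnDeriv P ω) (π₂.rnDeriv P ω) with h | h
    · rw [min_eq_left h, tsub_eq_zero_of_le h, add_zero]
    · rw [min_eq_right h, add_tsub_cancel_of_le h]
  · rw [← withDensity_add_left (m₁.min m₂)]
    conv_rhs => rw [← Measure.withDensity_rnDeriv_eq π₂ P h₂]
    congr 1
    ext ω
    simp only [Pi.add_apply]
    rcases le_total (π₁.rnDeriv P ω) (π₂.rnDeriv P ω) with h | h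
    · rw [min_eq_left h, add_tsub_cancel_of_le h]
    · rw [min_eq_right h, tsub_eq_zero_of_le h, add_zero]
  · have hi : Integrable (fun ω => |(π₁.rnDeriv P ω).toReal - (π₂.rnDeriv P ω).toReal|) P :=
      ((Measure.integrable_toReal_rnDeriv (μ := π₁) (ν := P)).sub
      (Measure.integrable_toReal_rnDeriv (μ := π₂) (ν := P))).abs
    rw [withDensity_apply _ MeasurableSet.univ, setLIntegral_univ,
      ofReal_integral_eq_lintegral_ofReal hi (ae_of_all _ fun _ => abs_nonneg _)]
    refine lintegral_mono_ae ?_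
    filter_upwards [π₁.rnDeriv_lt_top P, π₂.rnDeriv_lt_top P] with ω h1 h2
    rw [← ENNReal.ofReal_toReal h1.ne, ← ENNReal.ofReal_toReal h2.ne,
      ← ENNReal.ofReal_sub _ ENNReal.toReal_nonneg, ENNReal.toReal_ofReal ENNReal.toReal_nonneg,
      ENNReal.toReal_ofReal ENNReal.toReal_nonneg]
    exact ENNReal.ofReal_le_ofReal (le_abs_self _)

lemma smul_smul_measure_of_univ (σ : Measure Ω) (h : σ univ ≠ ⊤) :
    (σ univ)⁻¹ • σ univ • σ = σ := by
  by_cases h0 : σ univ = 0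
  · rw [Measure.measure_univ_eq_zero] at h0
    simp [h0]
  · rw [smul_smul, ENNReal.inv_mul_cancel h0 h, one_smul]

/-- The coupling that is optimal for the total variation distance. -/
lemma isCoupling_diag_add_prod {κ σ₁ σ₂ : Measure Ω} [IsFiniteMeasure σ₁] [IsFiniteMeasure σ₂]
    (h : σ₁ univ = σ₂ univ) : IsCoupling (κ + σ₁) (κ + σ₂)
      (κ.map (fun ω => (ω, ω)) + (σ₁ univ)⁻¹ • σ₁.prod σ₂) := by
  have hd : Measurable fun ω : Ω => (ω, ω) := measurable_id.prodMk measurable_id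
  constructor
  · rw [Measure.map_add _ _ measurable_fst, Measure.map_smul, Measure.map_map measurable_fst hd,
      Measure.map_fst_prod, ← h, smul_smul_measure_of_univ _ (measure_ne_top _ _)]
    exact congrArg (· + σ₁) Measure.map_id
  · rw [Measure.map_add _ _ measurable_snd, Measure.map_smul, Measure.map_map measurable_snd hd,
      Measure.map_snd_prod, h, smul_smul_measure_of_univ _ (measure_ne_top _ _)]
    exact congrArg (· + σ₂) Measure.map_id

variable {A B : Type*} [MetricSpace A] [PolishSpace A] [MeasurableSpace A] [BorelSpace A]
  [MetricSpace B] [PolishSpace B] [MeasurableSpace B] [BorelSpace B]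

omit [PolishSpace A] [MeasurableSpace A] [BorelSpace A] [PolishSpace B] [MeasurableSpace B]
  [BorelSpace B] in
lemma edist_rpow_add_le_growthFn {p : ℝ} (hp : 1 ≤ p) (x₀ : A) (y₀ : B) (z z' : A × B) :
    edist z.1 z'.1 ^ p + edist z.2 z'.2 ^ p ≤
      2 ^ (p - 1) * (growthFn p x₀ y₀ z + growthFn p x₀ y₀ z') := by
  have h1 := edist_rpow_le hp z.1 z'.1 x₀
  have h2 := edist_rpow_le hp z.2 z'.2 y₀
  refine (add_le_add h1 h2).trans ?_
  rw [← mul_add]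
  gcongr 2 ^ (p - 1) * ?_
  rw [add_add_add_comm, growthFn, growthFn, edist_comm x₀, edist_comm x₀, edist_comm y₀,
    edist_comm y₀]
  gcongr ?_ + ?_ + (?_ + ?_) <;> exact le_add_self

/-- Couplings that are close in total variation are close in Wasserstein distance. -/
lemma exists_coupling_lcost2_le {p : ℝ} (hp : 1 ≤ p) {μ : Measure A} {ν : Measure B}
    [IsProbabilityMeasure μ] [IsProbabilityMeasure ν] (hμ : MemPp p μ) (hν : MemPp p ν)
    {δ : ℝ≥0∞} (hδ : δ ≠ 0) : ∃ η : ℝ≥0∞, η ≠ 0 ∧ ∀ κ σ₁ σ₂ : Measure (A × B),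
      IsCoupling μ ν (κ + σ₁) → IsCoupling μ ν (κ + σ₂) → σ₁ univ ≤ η →
      ∃ τ, IsCoupling (κ + σ₁) (κ + σ₂) τ ∧ lcost2 p τ ≤ δ := by
  obtain ⟨z₀⟩ : Nonempty (A × B) := by
    have := (μ.prod ν).nonempty_of_neZero
    exact this
  set Q : ℝ≥0∞ := 2 ^ (p - 1) with hQ
  have hQ0 : Q ≠ 0 := (zero_lt_one.trans_le (one_le_two_rpow_sub_one hp)).ne'
  have hQt : Q ≠ ⊤ := ENNReal.rpow_ne_top_of_nonneg (by linarith) ENNReal.ofNat_ne_top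
  have ht0 : δ / (4 * Q) ≠ 0 :=
    (ENNReal.div_pos hδ (ENNReal.mul_ne_top ENNReal.ofNat_ne_top hQt)).ne'
  obtain ⟨R, hR⟩ := exists_growthFn_tail hμ hν z₀.1 z₀.2 ht0
  set t := δ / (4 * Q) with ht
  refine ⟨t / (R + 1), (ENNReal.div_pos ht0 (by simp)).ne', fun κ σ₁ σ₂ h₁ h₂ hσ => ?_⟩
  have := isProbabilityMeasure_of_map measurable_fst h₁.1
  have := isProbabilityMeasure_of_map measurable_fst h₂.1
  have le₁ : σ₁ ≤ κ + σ₁ := Measure.le_add_left le_rfl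
  have le₂ : σ₂ ≤ κ + σ₂ := Measure.le_add_left le_rfl
  have : IsFiniteMeasure σ₁ := isFiniteMeasure_of_le _ le₁
  have : IsFiniteMeasure σ₂ := isFiniteMeasure_of_le _ le₂
  have : IsFiniteMeasure κ := isFiniteMeasure_of_le (κ + σ₁) (Measure.le_add_right le_rfl)
  have hu : σ₁ univ = σ₂ univ := by
    have e₁ : (κ + σ₁) univ = 1 := measure_univ
    have e₂ : (κ + σ₂) univ = 1 := measure_univ
    rw [Measure.add_apply] at e₁ e₂
    exact (ENNReal.add_right_inj (measure_ne_top κ univ)).1 (e₁.trans e₂.symm)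
  refine ⟨_, isCoupling_diag_add_prod hu, ?_⟩
  set a := σ₁ univ with ha
  have haR : R * a ≤ t := by
    calc R * a ≤ (R + 1) * (t / (R + 1)) := by
          gcongr
          exact le_self_add
      _ = t := ENNReal.mul_div_cancel (by simp) (by simp)
  have b₁ : ∫⁻ z, growthFn p z₀.1 z₀.2 z ∂σ₁ ≤ t + t := by
    rw [← setLIntegral_univ]
    refine (hR σ₁ univ ?_ ?_).trans (by gcongr)
    · exact (Measure.map_mono le₁ measurable_fst).trans h₁.1.le
    · exact (Measure.map_mono le₁ measurable_snd).trans h₁.2.le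
  have b₂ : ∫⁻ z, growthFn p z₀.1 z₀.2 z ∂σ₂ ≤ t + t := by
    rw [← setLIntegral_univ]
    refine (hR σ₂ univ ?_ ?_).trans (by rw [← hu]; gcongr)
    · exact (Measure.map_mono le₂ measurable_fst).trans h₂.1.le
    · exact (Measure.map_mono le₂ measurable_snd).trans h₂.2.le
  have mH := measurable_growthFn p z₀.1 z₀.2
  have mcost : Measurable fun z : (A × B) × (A × B) =>
      edist z.1.1 z.2.1 ^ p + edist z.1.2 z.2.2 ^ p := by
    fun_prop
  have mH₁ : Measurable fun z : (A × B) × (A × B) => growthFn p z₀.1 z₀.2 z.1 :=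
    mH.comp measurable_fst
  have mH₂ : Measurable fun z : (A × B) × (A × B) => growthFn p z₀.1 z₀.2 z.2 :=
    mH.comp measurable_snd
  have hdiag : ∫⁻ z, (edist z.1.1 z.2.1 ^ p + edist z.1.2 z.2.2 ^ p)
      ∂(κ.map fun z : A × B => (z, z)) = 0 := by
    have hd : Measurable fun z : A × B => (z, z) := measurable_id.prodMk measurable_id
    rw [lintegral_map mcost hd]
    simp [zero_lt_one.trans_le hp]
  have hprod : ∫⁻ z, (edist z.1.1 z.2.1 ^ p + edist z.1.2 z.2.2 ^ p) ∂(σ₁.prod σ₂) ≤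
      a * δ := by
    calc ∫⁻ z, (edist z.1.1 z.2.1 ^ p + edist z.1.2 z.2.2 ^ p) ∂(σ₁.prod σ₂)
        ≤ ∫⁻ z, Q * (growthFn p z₀.1 z₀.2 z.1 + growthFn p z₀.1 z₀.2 z.2) ∂(σ₁.prod σ₂) :=
          lintegral_mono fun z => edist_rpow_add_le_growthFn hp _ _ _ _
      _ = Q * ((∫⁻ z, growthFn p z₀.1 z₀.2 z ∂σ₁) * a + a * ∫⁻ z, growthFn p z₀.1 z₀.2 z ∂σ₂) := by
          rw [lintegral_const_mul' _ _ hQt, lintegral_add_left mH₁]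
          congr 2
          · rw [lintegral_prod _ mH₁.aemeasurable]
            simp only [lintegral_const, ← hu]
            exact lintegral_mul_const _ mH
          · rw [lintegral_prod _ mH₂.aemeasurable]
            simp only [lintegral_const]
            rw [mul_comm]
      _ ≤ Q * ((t + t) * a + a * (t + t)) := by gcongr
      _ = a * (4 * Q * t) := by ring
      _ = a * δ := by
          rw [ht, ENNReal.mul_div_cancel (mul_ne_zero four_ne_zero hQ0)
            (ENNReal.mul_ne_top ENNReal.ofNat_ne_top hQt)]
  rw [lcost2, lintegral_add_measure, hdiag, zero_add, lintegral_smul_measure, smul_eq_mul]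
  calc a⁻¹ * ∫⁻ z, (edist z.1.1 z.2.1 ^ p + edist z.1.2 z.2.2 ^ p) ∂(σ₁.prod σ₂)
      ≤ a⁻¹ * (a * δ) := by gcongr
    _ = (a⁻¹ * a) * δ := (mul_assoc _ _ _).symm
    _ ≤ 1 * δ := by gcongr; exact ENNReal.inv_mul_le_one a
    _ = δ := one_mul _

end TotalVariationCoupling

section Gluing

variable {E₁ E₂ E₃ : Type*} [MeasurableSpace E₁] [MeasurableSpace E₂] [MeasurableSpace E₃]
  [StandardBorelSpace E₃]

lemma exists_gluing {θ : Measure (E₁ × E₂)} {τ : Measure (E₂ × E₃)} [IsProbabilityMeasure θ]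
    [IsProbabilityMeasure τ] (h : θ.map Prod.snd = τ.map Prod.fst) :
    ∃ ρ : Measure ((E₁ × E₂) × E₃), ρ.map Prod.fst = θ ∧ ρ.map (fun z => (z.1.2, z.2)) = τ := by
  have : Nonempty E₃ := (τ.nonempty_of_neZero).map Prod.snd
  refine ⟨θ ⊗ₘ (τ.condKernel.comap Prod.snd measurable_snd), Measure.fst_compProd _ _, ?_⟩
  have hm : Measurable fun z : (E₁ × E₂) × E₃ => (z.1.2, z.2) := by fun_prop
  conv_rhs => rw [← τ.disintegrate τ.condKernel, Measure.fst, ← h]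
  ext s hs
  rw [Measure.map_apply hm hs, Measure.compProd_apply (hm hs), Measure.compProd_apply hs,
    lintegral_map (Kernel.measurable_kernel_prodMk_left hs) measurable_snd]
  rfl

lemma exists_coupling_lcost2_le_add {A B : Type*} [PseudoEMetricSpace A] [MeasurableSpace A]
    [OpensMeasurableSpace A] [SecondCountableTopology A] [StandardBorelSpace A]
    [PseudoEMetricSpace B] [MeasurableSpace B] [OpensMeasurableSpace B]
    [SecondCountableTopology B] [StandardBorelSpace B] {p : ℝ} (hp : 1 ≤ p)
    {θ τ : Measure ((A × B) × (A × B))} [IsProbabilityMeasure θ] [IsProbabilityMeasure τ]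
    (h : θ.map Prod.snd = τ.map Prod.fst) :
    ∃ ρ, IsCoupling (θ.map Prod.fst) (τ.map Prod.snd) ρ ∧
      lcost2 p ρ ≤ 2 ^ (p - 1) * (lcost2 p θ + lcost2 p τ) := by
  obtain ⟨ζ, h1, h2⟩ := exists_gluing h
  have hm : Measurable fun z : ((A × B) × (A × B)) × (A × B) => (z.1.2, z.2) := by fun_prop
  have hm' : Measurable fun z : ((A × B) × (A × B)) × (A × B) => (z.1.1, z.2) := by fun_prop
  have mcost : Measurable fun z : (A × B) × (A × B) =>
      edist z.1.1 z.2.1 ^ p + edist z.1.2 z.2.2 ^ p := by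
    fun_prop
  have m₁ : Measurable fun z : ((A × B) × (A × B)) × (A × B) =>
      edist z.1.1.1 z.1.2.1 ^ p + edist z.1.1.2 z.1.2.2 ^ p := mcost.comp measurable_fst
  refine ⟨ζ.map fun z => (z.1.1, z.2), ⟨?_, ?_⟩, ?_⟩
  · rw [Measure.map_map measurable_fst hm', ← h1, Measure.map_map measurable_fst measurable_fst]
    rfl
  · rw [Measure.map_map measurable_snd hm', ← h2, Measure.map_map measurable_snd hm]
    rfl
  · rw [← h1, ← h2]
    simp only [lcost2]
    rw [lintegral_map mcost hm', lintegral_map mcost measurable_fst, lintegral_map mcost hm,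
      ← lintegral_add_left m₁, ← lintegral_const_mul' _ _
        (ENNReal.rpow_ne_top_of_nonneg (by linarith) ENNReal.ofNat_ne_top)]
    refine lintegral_mono fun z => ?_
    refine (add_le_add (edist_rpow_le hp z.1.1.1 z.2.1 z.1.2.1)
      (edist_rpow_le hp z.1.1.2 z.2.2 z.1.2.2)).trans (le_of_eq ?_)
    rw [edist_comm z.2.1, edist_comm z.2.2, ← mul_add, add_add_add_comm]

end Gluing

section EntropicObjective

lemma entObj_eq_coe {Ω : Type*} [MeasurableSpace Ω] (c : Ω → ℝ) (ε : ℝ) {P π : Measure Ω}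
    (h : KL π P ≠ ⊤) : entObj c ε P π = ((∫ z, c z ∂π + ε * (KL π P).toReal : ℝ) : EReal) := by
  rw [entObj, EReal.coe_add, EReal.coe_mul, EReal.coe_ennreal_toReal h]

lemma entObj_eq_top {Ω : Type*} [MeasurableSpace Ω] (c : Ω → ℝ) {ε : ℝ} (hε : 0 < ε)
    {P π : Measure Ω} (h : KL π P = ⊤) : entObj c ε P π = ⊤ := by
  rw [entObj, h, EReal.coe_ennreal_top, EReal.coe_mul_top_of_pos hε, EReal.coe_add_top]

lemma lcost2_map_swap {A B : Type*} [MeasurableSpace A] [MeasurableSpace B]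
    [PseudoEMetricSpace A] [PseudoEMetricSpace B] (p : ℝ) (θ : Measure ((A × B) × (A × B))) :
    lcost2 p (θ.map Prod.swap) = lcost2 p θ := by
  rw [lcost2, show (Prod.swap : (A × B) × (A × B) → _) =
    (MeasurableEquiv.prodComm : (A × B) × (A × B) ≃ᵐ _) from rfl, lintegral_map_equiv]
  refine lintegral_congr fun z => ?_
  change edist z.2.1 z.1.1 ^ p + edist z.2.2 z.1.2 ^ p = _
  rw [edist_comm z.2.1, edist_comm z.2.2]

variable {X Y : Fin N → Type*}
    [∀ t, MeasurableSpace (X t)] [∀ t, MetricSpace (X t)]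
    [∀ t, PolishSpace (X t)] [∀ t, BorelSpace (X t)]
    [∀ t, MeasurableSpace (Y t)] [∀ t, MetricSpace (Y t)]
    [∀ t, PolishSpace (Y t)] [∀ t, BorelSpace (Y t)]
    {p ε : ℝ} {c : (∀ t, X t) × (∀ t, Y t) → ℝ}
    {μ : Measure (∀ t, X t)} {ν : Measure (∀ t, Y t)}
    [IsProbabilityMeasure μ] [IsProbabilityMeasure ν]

/-- The entropic transport value is finite. -/
lemma exists_EE_eq_coe (hp : 1 ≤ p) (hε : 0 < ε) (hcg : GrowthLE p c)
    (hμ : MemPp p μ) (hν : MemPp p ν) (b : Flavor) : ∃ e : ℝ, EE b μ ν c ε = e := by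
  have hp0 : 0 ≤ p := zero_le_one.trans hp
  obtain ⟨x₀, y₀, M, hM⟩ := hcg.enorm_le hp0
  set L : ℝ≥0∞ := M * (∫⁻ x, (1 + edist x₀ x ^ p) ∂μ + ∫⁻ y, (1 + edist y₀ y ^ p) ∂ν) with hL
  have hLt : L ≠ ⊤ := ENNReal.mul_ne_top ENNReal.coe_ne_top (ENNReal.add_ne_top.2
    ⟨hμ.lintegral_one_add_ne_top x₀, hν.lintegral_one_add_ne_top y₀⟩)
  have hlow : ((-L.toReal : ℝ) : EReal) ≤ EE b μ ν c ε := by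
    refine le_iInf fun π => ?_
    by_cases hK : KL π.1 (μ.prod ν) = ⊤
    · rw [entObj_eq_top c hε hK]
      exact le_top
    · rw [entObj_eq_coe c ε hK, EReal.coe_le_coe_iff]
      have h : ‖∫ z, c z ∂π.1‖ₑ ≤ L := by
        refine (enorm_integral_le_lintegral_enorm _).trans ((lintegral_mono hM).trans ?_)
        rw [lintegral_const_mul _ (measurable_growthFn p x₀ y₀), lintegral_growthFn π.2.1]
      have h' : |∫ z, c z ∂π.1| ≤ L.toReal := by
        rw [← Real.norm_eq_abs, ← toReal_enorm]
        exact ENNReal.toReal_mono hLt h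
      have : 0 ≤ ε * (KL π.1 (μ.prod ν)).toReal := by positivity
      linarith [neg_abs_le (∫ z, c z ∂π.1)]
  have hup : EE b μ ν c ε ≤ ((∫ z, c z ∂(μ.prod ν) : ℝ) : EReal) := by
    refine (iInf_le _ ⟨μ.prod ν, prod_mem_aCouplings b μ ν⟩).trans (le_of_eq ?_)
    have hK : KL (μ.prod ν) (μ.prod ν) = 0 := by
      rw [KL_eq_klDiv, InformationTheory.klDiv_self]
    rw [entObj_eq_coe c ε (by simp [hK]), hK]
    simp
  exact ⟨(EE b μ ν c ε).toReal, (EReal.coe_toReal (ne_top_of_le_ne_top (EReal.coe_ne_top _) hup)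
    (ne_bot_of_le_ne_bot (EReal.coe_ne_bot _) hlow)).symm⟩

section Value

variable {b : Flavor} {e : ℝ} (he : EE b μ ν c ε = e)
include he

omit [∀ t, MetricSpace (X t)] [∀ t, PolishSpace (X t)] [∀ t, BorelSpace (X t)]
  [∀ t, MetricSpace (Y t)] [∀ t, PolishSpace (Y t)] [∀ t, BorelSpace (Y t)]
  [IsProbabilityMeasure μ] [IsProbabilityMeasure ν]

lemma le_objective_of_EE_eq {π : Measure ((∀ t, X t) × (∀ t, Y t))} (hπ : π ∈ aCouplings b μ ν)
    (hK : KL π (μ.prod ν) ≠ ⊤) : e ≤ ∫ z, c z ∂π + ε * (KL π (μ.prod ν)).toReal := by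
  rw [← EReal.coe_le_coe_iff, ← entObj_eq_coe c ε hK, ← he]
  exact iInf_le (fun π : aCouplings b μ ν => entObj c ε (μ.prod ν) π.1) ⟨π, hπ⟩

lemma objective_eq_of_entObj_eq (hε : 0 < ε) {π : Measure ((∀ t, X t) × (∀ t, Y t))}
    (h : entObj c ε (μ.prod ν) π = EE b μ ν c ε) : KL π (μ.prod ν) ≠ ⊤ ∧
      ∫ z, c z ∂π + ε * (KL π (μ.prod ν)).toReal = e := by
  have hK : KL π (μ.prod ν) ≠ ⊤ := fun hK => by
    rw [entObj_eq_top c hε hK, he] at h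
    exact EReal.coe_ne_top _ h.symm
  rw [entObj_eq_coe c ε hK, he, EReal.coe_eq_coe_iff] at h
  exact ⟨hK, h⟩

lemma exists_objective_le_of_EE_eq (hε : 0 < ε) {δ : ℝ} (hδ : 0 < δ) :
    ∃ π ∈ aCouplings b μ ν, KL π (μ.prod ν) ≠ ⊤ ∧
      ∫ z, c z ∂π + ε * (KL π (μ.prod ν)).toReal ≤ e + δ := by
  have h : EE b μ ν c ε < ((e + δ : ℝ) : EReal) := by
    rw [he, EReal.coe_lt_coe_iff]
    linarith
  obtain ⟨⟨π, hπ⟩, hlt⟩ := iInf_lt_iff.1 h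
  have hK : KL π (μ.prod ν) ≠ ⊤ := fun hK => by
    rw [entObj_eq_top c hε hK] at hlt
    exact not_top_lt hlt
  rw [entObj_eq_coe c ε hK, EReal.coe_lt_coe_iff] at hlt
  exact ⟨π, hπ, hK, hlt.le⟩

end Value

/-- Transfer of couplings along bicausal couplings of the marginals with small cost. -/
lemma exists_transfer (hp : 1 ≤ p) (hc : Continuous c) (hcg : GrowthLE p c)
    (hμ : MemPp p μ) (hν : MemPp p ν) (b : Flavor) {δ : ℝ} (hδ : 0 < δ) :
    ∃ η : ℝ≥0∞, η ≠ 0 ∧ ∀ (μ' : Measure (∀ t, X t)) (ν' : Measure (∀ t, Y t))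
      [IsProbabilityMeasure μ'] [IsProbabilityMeasure ν'], MemPp p μ' → MemPp p ν' →
      ∀ γ ∈ aCouplings .bicausal μ' μ, ∀ γ' ∈ aCouplings .bicausal ν' ν,
      lcost p γ + lcost p γ' ≤ η →
      (∀ π' ∈ aCouplings b μ' ν', ∃ θ : Measure _, θ.map Prod.fst = π' ∧
        θ.map Prod.snd ∈ aCouplings b μ ν ∧
        KL (θ.map Prod.snd) (μ.prod ν) ≤ KL π' (μ'.prod ν') ∧
        |∫ z, c z ∂π' - ∫ z, c z ∂(θ.map Prod.snd)| ≤ δ ∧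
        lcost2 p θ = lcost p γ + lcost p γ') ∧
      (∀ π ∈ aCouplings b μ ν, ∃ π' ∈ aCouplings b μ' ν',
        KL π' (μ'.prod ν') ≤ KL π (μ.prod ν) ∧ |∫ z, c z ∂π' - ∫ z, c z ∂π| ≤ δ) := by
  obtain ⟨η, hη, h⟩ := hcg.exists_abs_integral_sub_le hp hc hμ hν hδ
  refine ⟨η, hη, fun μ' ν' _ _ hμ' hν' γ hγ γ' hγ' hcost => ⟨fun π' hπ' => ?_, fun π hπ => ?_⟩⟩
  · obtain ⟨θ, h1, h2, h3, h4⟩ := exists_shadow hπ' hγ hγ'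
    have := isProbabilityMeasure_of_map measurable_fst hπ'.1.1
    have := isProbabilityMeasure_of_map measurable_fst h1
    refine ⟨θ, h1, h2, h3, ?_, h4 p⟩
    have := h μ' ν' θ inferInstance inferInstance hμ' hν' inferInstance (h1 ▸ hπ'.1) h2.1
      ((h4 p).trans_le hcost)
    rwa [h1] at this
  · obtain ⟨θ, h1, h2, h3, h4⟩ := exists_shadow hπ (map_swap_mem_aCouplings_bicausal hγ)
      (map_swap_mem_aCouplings_bicausal hγ')
    have := isProbabilityMeasure_of_map measurable_fst hπ.1.1
    have := isProbabilityMeasure_of_map measurable_fst h1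
    have : IsProbabilityMeasure (θ.map Prod.swap) :=
      Measure.isProbabilityMeasure_map measurable_swap.aemeasurable
    have e1 : (θ.map Prod.swap).map Prod.fst = θ.map Prod.snd :=
      Measure.map_map measurable_fst measurable_swap
    have e2 : (θ.map Prod.swap).map Prod.snd = π :=
      (Measure.map_map measurable_snd measurable_swap).trans h1
    refine ⟨θ.map Prod.snd, h2, h3, ?_⟩
    have := h μ' ν' (θ.map Prod.swap) inferInstance inferInstance hμ' hν' inferInstance
      (e1 ▸ h2.1) (e2 ▸ hπ.1) (by
        rw [lcost2_map_swap, h4 p, lcost_map_swap, lcost_map_swap]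
        exact hcost)
    rwa [e1, e2] at this

/-- Near-optimizers of the entropic problem are close in Wasserstein distance. -/
lemma exists_coupling_of_near_optimal (hp : 1 ≤ p) (hε : 0 < ε) (hc : Continuous c)
    (hcg : GrowthLE p c) (hμ : MemPp p μ) (hν : MemPp p ν) {b : Flavor} {e : ℝ}
    (he : EE b μ ν c ε = e) {δ : ℝ≥0∞} (hδ : δ ≠ 0) :
    ∃ ζ : ℝ, 0 < ζ ∧ ∀ π₁ ∈ aCouplings b μ ν, ∀ π₂ ∈ aCouplings b μ ν,
      KL π₁ (μ.prod ν) ≠ ⊤ → KL π₂ (μ.prod ν) ≠ ⊤ →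
      ∫ z, c z ∂π₁ + ε * (KL π₁ (μ.prod ν)).toReal ≤ e + ζ →
      ∫ z, c z ∂π₂ + ε * (KL π₂ (μ.prod ν)).toReal ≤ e + ζ →
      ∃ τ, IsCoupling π₁ π₂ τ ∧ lcost2 p τ ≤ δ := by
  obtain ⟨η, hη, h⟩ := exists_coupling_lcost2_le hp hμ hν hδ
  obtain ⟨r, hr0, hr⟩ := ENNReal.lt_iff_exists_nnreal_btwn.1 (pos_iff_ne_zero.2 hη)
  have hr0 : 0 < (r : ℝ) := by exact_mod_cast hr0
  refine ⟨ε * (r / 4) * (r / 4), by positivity, fun π₁ h₁ π₂ h₂ K₁ K₂ J₁ J₂ => ?_⟩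
  have := isProbabilityMeasure_of_map measurable_fst h₁.1.1
  have := isProbabilityMeasure_of_map measurable_fst h₂.1.1
  have := isProbabilityMeasure_half_add π₁ π₂
  have hm := half_add_mem_aCouplings h₁ h₂
  have hp0 : 0 ≤ p := zero_le_one.trans hp
  have i₁ := hcg.integrable hp0 hc hμ hν h₁.1
  have i₂ := hcg.integrable hp0 hc hμ hν h₂.1
  rw [KL_eq_klDiv] at K₁ K₂ J₁ J₂
  obtain ⟨Km, htv⟩ := integral_abs_rnDeriv_sub_le K₁ K₂
  have Jm := le_objective_of_EE_eq he hm (by rwa [KL_eq_klDiv])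
  rw [KL_eq_klDiv, integral_smul_measure, integral_add_measure i₁ i₂, smul_eq_mul,
    ENNReal.toReal_inv, ENNReal.toReal_ofNat] at Jm
  have htv := htv (r / 4) (by positivity)
  set k₁ := (InformationTheory.klDiv π₁ (μ.prod ν)).toReal
  set k₂ := (InformationTheory.klDiv π₂ (μ.prod ν)).toReal
  set k := (InformationTheory.klDiv ((2⁻¹ : ℝ≥0∞) • (π₁ + π₂)) (μ.prod ν)).toReal
  have hgap : k₁ / 2 + k₂ / 2 - k ≤ r / 4 * (r / 4) := by
    refine le_of_mul_le_mul_left ?_ hε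
    nlinarith
  have htv' : ∫ ω, |(π₁.rnDeriv (μ.prod ν) ω).toReal - (π₂.rnDeriv (μ.prod ν) ω).toReal|
      ∂(μ.prod ν) ≤ r := by
    refine htv.trans ?_
    calc 2 / (r / 4 : ℝ) * (k₁ / 2 + k₂ / 2 - k) + 2 * (r / 4)
        ≤ 2 / (r / 4 : ℝ) * (r / 4 * (r / 4)) + 2 * (r / 4) := by gcongr
      _ = r := by field_simp; ring
  obtain ⟨κ, σ₁, σ₂, rfl, rfl, hσ⟩ := exists_add_eq_add_eq
    (InformationTheory.klDiv_ne_top_iff.1 K₁).1 (InformationTheory.klDiv_ne_top_iff.1 K₂).1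
  refine h κ σ₁ σ₂ h₁.1 h₂.1 (hσ.trans ((ENNReal.ofReal_le_ofReal htv').trans ?_))
  rw [ENNReal.ofReal_coe_nnreal]
  exact hr.le

end EntropicObjective

section Stability

lemma eventually_exists_lcost_le {X : Fin N → Type*} [∀ t, MeasurableSpace (X t)]
    [∀ t, PseudoEMetricSpace (X t)] {p : ℝ} (hp : 1 ≤ p) {b : Flavor}
    {μ : Measure (∀ t, X t)} {μs : ℕ → Measure (∀ t, X t)}
    (h : Tendsto (fun n => W p b (μs n) μ) atTop (𝓝 0)) {η : ℝ≥0∞} (hη : η ≠ 0) :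
    ∀ᶠ n in atTop, ∃ γ ∈ aCouplings b (μs n) μ, lcost p γ ≤ η := by
  have hp0 : 0 < 1 / p := by positivity
  have hη' : 0 < η ^ (1 / p) := pos_iff_ne_zero.2 fun h0 =>
    hη ((ENNReal.rpow_eq_zero_iff_of_pos hp0).1 h0)
  filter_upwards [h.eventually_lt_const hη'] with n hn
  rw [W, ENNReal.rpow_lt_rpow_iff hp0] at hn
  obtain ⟨⟨γ, hγ⟩, hlt⟩ := iInf_lt_iff.1 hn
  exact ⟨γ, hγ, hlt.le⟩

lemma tendsto_W2_of_eventually {X Y : Fin N → Type*} [∀ t, MeasurableSpace (X t)]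
    [∀ t, MeasurableSpace (Y t)] [∀ t, PseudoEMetricSpace (X t)]
    [∀ t, PseudoEMetricSpace (Y t)] {p : ℝ} (hp : 1 ≤ p)
    {π : Measure ((∀ t, X t) × (∀ t, Y t))} {πs : ℕ → Measure ((∀ t, X t) × (∀ t, Y t))}
    (h : ∀ δ : ℝ≥0∞, δ ≠ 0 → ∀ᶠ n in atTop, ∃ ρ, IsCoupling (πs n) π ρ ∧ lcost2 p ρ ≤ δ) :
    Tendsto (fun n => W2 p .plain (πs n) π) atTop (𝓝 0) := by
  have hp0 : 0 < 1 / p := by positivity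
  have h0 : Tendsto (fun n => ⨅ θ : aCouplings2 .plain (πs n) π, lcost2 p θ.1) atTop (𝓝 0) := by
    refine ENNReal.tendsto_nhds_zero.2 fun δ hδ => ?_
    filter_upwards [h δ hδ.ne'] with n ⟨ρ, hρ, hle⟩
    exact (iInf_le (fun θ : aCouplings2 .plain (πs n) π => lcost2 p θ.1)
      ⟨ρ, hρ, trivial⟩).trans hle
  simpa [W2, ENNReal.zero_rpow_of_pos (zero_lt_one.trans_le hp |> inv_pos.2)] using
    h0.ennrpow_const (1 / p)

variable {X Y : Fin N → Type*}
    [∀ t, MeasurableSpace (X t)] [∀ t, MetricSpace (X t)]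
    [∀ t, PolishSpace (X t)] [∀ t, BorelSpace (X t)]
    [∀ t, MeasurableSpace (Y t)] [∀ t, MetricSpace (Y t)]
    [∀ t, PolishSpace (Y t)] [∀ t, BorelSpace (Y t)]
    {p ε : ℝ} {c : (∀ t, X t) × (∀ t, Y t) → ℝ}
    {μ : Measure (∀ t, X t)} {ν : Measure (∀ t, Y t)}
    [IsProbabilityMeasure μ] [IsProbabilityMeasure ν]
    {μs : ℕ → Measure (∀ t, X t)} {νs : ℕ → Measure (∀ t, Y t)}
    [∀ n, IsProbabilityMeasure (μs n)] [∀ n, IsProbabilityMeasure (νs n)]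

lemma eventually_transfer (hp : 1 ≤ p) (hc : Continuous c) (hcg : GrowthLE p c)
    (hμ : MemPp p μ) (hν : MemPp p ν) (hμs : ∀ n, MemPp p (μs n)) (hνs : ∀ n, MemPp p (νs n))
    (hμconv : Tendsto (fun n => W p .bicausal (μs n) μ) atTop (𝓝 0))
    (hνconv : Tendsto (fun n => W p .bicausal (νs n) ν) atTop (𝓝 0))
    (b : Flavor) {δ : ℝ} (hδ : 0 < δ) {η : ℝ≥0∞} (hη : η ≠ 0) :
    ∀ᶠ n in atTop,
      (∀ π' ∈ aCouplings b (μs n) (νs n), ∃ θ : Measure _, θ.map Prod.fst = π' ∧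
        θ.map Prod.snd ∈ aCouplings b μ ν ∧
        KL (θ.map Prod.snd) (μ.prod ν) ≤ KL π' ((μs n).prod (νs n)) ∧
        |∫ z, c z ∂π' - ∫ z, c z ∂(θ.map Prod.snd)| ≤ δ ∧ lcost2 p θ ≤ η) ∧
      (∀ π ∈ aCouplings b μ ν, ∃ π' ∈ aCouplings b (μs n) (νs n),
        KL π' ((μs n).prod (νs n)) ≤ KL π (μ.prod ν) ∧
        |∫ z, c z ∂π' - ∫ z, c z ∂π| ≤ δ) := by
  obtain ⟨η₀, hη₀, h⟩ := exists_transfer hp hc hcg hμ hν b hδ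
  have hm : min η η₀ / 2 ≠ 0 :=
    (ENNReal.half_pos (lt_min (pos_iff_ne_zero.2 hη) (pos_iff_ne_zero.2 hη₀)).ne').ne'
  filter_upwards [eventually_exists_lcost_le hp hμconv hm,
    eventually_exists_lcost_le hp hνconv hm] with n ⟨γ, hγ, h₁⟩ ⟨γ', hγ', h₂⟩
  have hle : lcost p γ + lcost p γ' ≤ min η η₀ :=
    (add_le_add h₁ h₂).trans (ENNReal.add_halves _).le
  refine (h (μs n) (νs n) (hμs n) (hνs n) γ hγ γ' hγ' (hle.trans (min_le_right _ _))).imp_left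
    fun H π' hπ' => ?_
  obtain ⟨θ, h1, h2, h3, h4, h5⟩ := H π' hπ'
  exact ⟨θ, h1, h2, h3, h4, h5.trans_le (hle.trans (min_le_left _ _))⟩

lemma eventually_abs_value_sub_le (hp : 1 ≤ p) (hε : 0 < ε) (hc : Continuous c)
    (hcg : GrowthLE p c) (hμ : MemPp p μ) (hν : MemPp p ν)
    (hμs : ∀ n, MemPp p (μs n)) (hνs : ∀ n, MemPp p (νs n))
    (hμconv : Tendsto (fun n => W p .bicausal (μs n) μ) atTop (𝓝 0))
    (hνconv : Tendsto (fun n => W p .bicausal (νs n) ν) atTop (𝓝 0))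
    {b : Flavor} {e : ℝ} {es : ℕ → ℝ} (he : EE b μ ν c ε = e)
    (hes : ∀ n, EE b (μs n) (νs n) c ε = es n) {δ : ℝ} (hδ : 0 < δ) :
    ∀ᶠ n in atTop, |es n - e| ≤ δ := by
  filter_upwards [eventually_transfer hp hc hcg hμ hν hμs hνs hμconv hνconv b (half_pos hδ)
    one_ne_zero] with n ⟨hlow, hup⟩
  refine abs_sub_le_iff.2 ⟨?_, ?_⟩
  · obtain ⟨π, hπ, hK, hJ⟩ := exists_objective_le_of_EE_eq he hε (half_pos hδ)
    obtain ⟨π', hπ', hK', hI⟩ := hup π hπ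
    have := le_objective_of_EE_eq (hes n) hπ' (ne_top_of_le_ne_top hK hK')
    have := mul_le_mul_of_nonneg_left (ENNReal.toReal_mono hK hK') hε.le
    linarith [le_of_abs_le hI]
  · obtain ⟨π', hπ', hK, hJ⟩ := exists_objective_le_of_EE_eq (hes n) hε (half_pos hδ)
    obtain ⟨θ, -, hθ, hK', hI, -⟩ := hlow π' hπ'
    have := le_objective_of_EE_eq he hθ (ne_top_of_le_ne_top hK hK')
    have := mul_le_mul_of_nonneg_left (ENNReal.toReal_mono hK hK') hε.le
    linarith [neg_le_of_abs_le hI]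

lemma eventually_exists_coupling_optimizer (hp : 1 ≤ p) (hε : 0 < ε) (hc : Continuous c)
    (hcg : GrowthLE p c) (hμ : MemPp p μ) (hν : MemPp p ν)
    (hμs : ∀ n, MemPp p (μs n)) (hνs : ∀ n, MemPp p (νs n))
    (hμconv : Tendsto (fun n => W p .bicausal (μs n) μ) atTop (𝓝 0))
    (hνconv : Tendsto (fun n => W p .bicausal (νs n) ν) atTop (𝓝 0))
    {b : Flavor} {e : ℝ} {es : ℕ → ℝ} (he : EE b μ ν c ε = e)
    (hes : ∀ n, EE b (μs n) (νs n) c ε = es n)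
    {πs : ℕ → Measure ((∀ t, X t) × (∀ t, Y t))}
    (hπs : ∀ n, πs n ∈ aCouplings b (μs n) (νs n))
    (hopts : ∀ n, entObj c ε ((μs n).prod (νs n)) (πs n) = EE b (μs n) (νs n) c ε)
    {π : Measure ((∀ t, X t) × (∀ t, Y t))} (hπ : π ∈ aCouplings b μ ν)
    (hopt : entObj c ε (μ.prod ν) π = EE b μ ν c ε) {δ : ℝ≥0∞} (hδ : δ ≠ 0) :
    ∀ᶠ n in atTop, ∃ ρ, IsCoupling (πs n) π ρ ∧ lcost2 p ρ ≤ 2 ^ (p - 1) * (δ + δ) := by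
  obtain ⟨ζ, hζ, h⟩ := exists_coupling_of_near_optimal hp hε hc hcg hμ hν he hδ
  filter_upwards [eventually_transfer hp hc hcg hμ hν hμs hνs hμconv hνconv b (half_pos hζ) hδ,
    eventually_abs_value_sub_le hp hε hc hcg hμ hν hμs hνs hμconv hνconv he hes (half_pos hζ)]
    with n htrans hval
  obtain ⟨hKn, hJn⟩ := objective_eq_of_entObj_eq (hes n) hε (hopts n)
  obtain ⟨hK, hJ⟩ := objective_eq_of_entObj_eq he hε hopt
  obtain ⟨θ, h1, h2, h3, h4, h5⟩ := htrans.1 (πs n) (hπs n)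
  have hmul := mul_le_mul_of_nonneg_left (ENNReal.toReal_mono hKn h3) hε.le
  obtain ⟨τ, hτ, hτc⟩ := h (θ.map Prod.snd) h2 π hπ (ne_top_of_le_ne_top hKn h3) hK
    (by linarith [neg_le_of_abs_le h4, le_of_abs_le hval]) (by linarith)
  have := isProbabilityMeasure_of_map measurable_fst h2.1.1
  have := isProbabilityMeasure_of_map (π := θ) measurable_snd rfl
  have := isProbabilityMeasure_of_map measurable_fst hτ.1
  obtain ⟨ρ, hρ, hle⟩ := exists_coupling_lcost2_le_add hp hτ.1.symm
  rw [h1, hτ.2] at hρ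
  exact ⟨ρ, hρ, hle.trans (mul_le_mul_right (add_le_add h5 hτc) _)⟩

end Stability

/-- Qualitative stability of entropic adapted optimal transport: if
`W_{p,bc}(μⁿ, μ) → 0` and `W_{p,bc}(νⁿ, ν) → 0`, then
`E_•^ε(μⁿ, νⁿ, c) → E_•^ε(μ, ν, c)`, and the optimizers converge in `W_p`. -/
theorem stmt_8 {N : ℕ} (X Y : Fin N → Type*)
    [∀ t, MeasurableSpace (X t)] [∀ t, MetricSpace (X t)]
    [∀ t, PolishSpace (X t)] [∀ t, BorelSpace (X t)]
    [∀ t, MeasurableSpace (Y t)] [∀ t, MetricSpace (Y t)]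
    [∀ t, PolishSpace (Y t)] [∀ t, BorelSpace (Y t)]
    (p : ℝ) (hp : 1 ≤ p) (ε : ℝ) (hε : 0 < ε)
    (c : (∀ t, X t) × (∀ t, Y t) → ℝ) (hc : Continuous c) (hcg : GrowthLE p c)
    (μ : Measure (∀ t, X t)) (ν : Measure (∀ t, Y t))
    [IsProbabilityMeasure μ] [IsProbabilityMeasure ν]
    (hμp : MemPp p μ) (hνp : MemPp p ν)
    (μs : ℕ → Measure (∀ t, X t)) (νs : ℕ → Measure (∀ t, Y t))
    (hμs : ∀ n, IsProbabilityMeasure (μs n)) (hνs : ∀ n, IsProbabilityMeasure (νs n))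
    (hμsp : ∀ n, MemPp p (μs n)) (hνsp : ∀ n, MemPp p (νs n))
    (hμconv : Tendsto (fun n => W p .bicausal (μs n) μ) atTop (𝓝 0))
    (hνconv : Tendsto (fun n => W p .bicausal (νs n) ν) atTop (𝓝 0))
    (b : Flavor) :
    Tendsto (fun n => EE b (μs n) (νs n) c ε) atTop (𝓝 (EE b μ ν c ε)) ∧
    ∀ πs : ℕ → Measure ((∀ t, X t) × (∀ t, Y t)),
      (∀ n, πs n ∈ aCouplings b (μs n) (νs n)) →
      (∀ n, entObj c ε ((μs n).prod (νs n)) (πs n) = EE b (μs n) (νs n) c ε) →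
      ∀ π : Measure ((∀ t, X t) × (∀ t, Y t)),
        π ∈ aCouplings b μ ν →
        entObj c ε (μ.prod ν) π = EE b μ ν c ε →
        Tendsto (fun n => W2 p .plain (πs n) π) atTop (𝓝 0) := by


  choose es hes using fun n => exists_EE_eq_coe hp hε hcg (hμsp n) (hνsp n) b
  obtain ⟨e, he⟩ := exists_EE_eq_coe hp hε hcg hμp hνp b
  refine ⟨?_, fun πs hπs hopts π hπ hopt => tendsto_W2_of_eventually hp fun δ hδ => ?_⟩
  · simp_rw [hes, he]
    refine EReal.tendsto_coe.2 (Metric.tendsto_nhds.2 fun δ hδ => ?_)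
    filter_upwards [eventually_abs_value_sub_le hp hε hc hcg hμp hνp hμsp hνsp hμconv hνconv
      he hes (half_pos hδ)] with n hn
    rw [Real.dist_eq]
    linarith
  · set C : ℝ≥0∞ := 2 ^ (p - 1)
    have hC : C ≠ ⊤ := ENNReal.rpow_ne_top_of_nonneg (sub_nonneg.2 hp) ENNReal.ofNat_ne_top
    have hC0 : C ≠ 0 := (ENNReal.rpow_pos two_pos ENNReal.ofNat_ne_top).ne'
    have hδ' : δ / C / 2 ≠ 0 :=
      (ENNReal.half_pos (ENNReal.div_pos hδ hC).ne').ne'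
    filter_upwards [eventually_exists_coupling_optimizer hp hε hc hcg hμp hνp hμsp hνsp hμconv
      hνconv he hes hπs hopts hπ hopt hδ'] with n ⟨ρ, hρ, hle⟩
    refine ⟨ρ, hρ, hle.trans ?_⟩
    rw [ENNReal.add_halves]
    exact ENNReal.mul_div_le

end AOT
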